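/- arXiv:1905.05728 — 4 statements merged into one kernel-verified Lean document; each statement's English description precedes it below -/
import Mathlib

section
/- For every h ∈ (1,2) there exist a velocity W : [0,1]×ℝ² → ℝ², a compact set S ⊂ ℝ², and a map X : [0,1]×ℝ² → ℝ² such that: W is bounded and uniformly continuous on [0,1]×ℝ², W has compact support, W is weakly divergence free; the Hausdorff dimension of S equals h; X is a trajectory map for W on ℝ² and it is the unique one (any trajectory map for W on ℝ² coincides with X); for every t ∈ [0,1) the Hausdorff dimension of the image X(t, S) := {X(t,a) : a ∈ S} equals h; and X(1, S) = {(0,0)}. -/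
open MeasureTheory Set

noncomputable section

/-- Dot product on `ℝ × ℝ`. -/
def dot2 (u v : ℝ × ℝ) : ℝ := u.1 * v.1 + u.2 * v.2

/-- Spatial gradient of a scalar function on `ℝ × ℝ`. -/
def grad2 (ψ : ℝ × ℝ → ℝ) (x : ℝ × ℝ) : ℝ × ℝ :=
  (fderiv ℝ ψ x (1, 0), fderiv ℝ ψ x (0, 1))

/-- A velocity field is weakly divergence free at time `t`. -/
def WeakDivFreeAt (u : ℝ → ℝ × ℝ → ℝ × ℝ) (t : ℝ) : Prop :=
  ∀ ψ : ℝ × ℝ → ℝ, ContDiff ℝ (⊤ : ℕ∞) ψ → HasCompactSupport ψ →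
    ∫ x, dot2 (u t x) (grad2 ψ x) = 0

/-- Trajectory map of a velocity field on a set `A`, on the time interval `[0,T]`. -/
def IsTrajOn (T : ℝ) (U : ℝ → ℝ × ℝ → ℝ × ℝ) (A : Set (ℝ × ℝ))
    (X : ℝ → ℝ × ℝ → ℝ × ℝ) : Prop :=
  ∀ a ∈ A, X 0 a = a ∧
    ∀ t ∈ Icc (0 : ℝ) T, HasDerivWithinAt (fun s => X s a) (U t (X t a)) (Icc (0 : ℝ) T) t

open Filter Topology
open scoped NNReal ENNReal ContDiff

section Flow

variable {E : Type*} [NormedAddCommGroup E] [NormedSpace ℝ E]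

/-- Integral curves on `[0, 1]` are unique if the field is Lipschitz on every `[0, T]`, `T < 1`. -/
theorem eqOn_Icc_of_lipschitz_before_one {W : ℝ → E → E}
    (hL : ∀ T < (1 : ℝ), ∃ K, ∀ t ∈ Icc 0 T, LipschitzWith K (W t)) {T : ℝ} (hT : T ≤ 1) {f g : ℝ → E}
    (hf : ∀ t ∈ Icc (0 : ℝ) T, HasDerivWithinAt f (W t (f t)) (Icc 0 T) t)
    (hg : ∀ t ∈ Icc (0 : ℝ) T, HasDerivWithinAt g (W t (g t)) (Icc 0 T) t)
    (h0 : f 0 = g 0) : EqOn f g (Icc 0 T) := by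
  have hfc : ContinuousOn f (Icc 0 T) := fun t ht ↦ (hf t ht).continuousWithinAt
  have hgc : ContinuousOn g (Icc 0 T) := fun t ht ↦ (hg t ht).continuousWithinAt
  rcases le_or_gt T 0 with hT0 | hT0
  · intro t ht
    obtain rfl : t = 0 := le_antisymm (ht.2.trans hT0) ht.1
    exact h0
  have key : EqOn f g (Ico 0 T) := by
    intro t ht
    obtain ⟨K, hK⟩ := hL t (ht.2.trans_le hT)
    have hsub : Icc 0 t ⊆ Icc 0 T := Icc_subset_Icc_right ht.2.le
    have hder : ∀ {u : ℝ → E}, (∀ s ∈ Icc (0 : ℝ) T, HasDerivWithinAt u (W s (u s)) (Icc 0 T) s) →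
        ∀ s ∈ Ico 0 t, HasDerivWithinAt u (W s (u s)) (Ici s) s := fun hu s hs ↦
      (hu s ⟨hs.1, (hs.2.trans ht.2).le⟩).mono_of_mem_nhdsWithin
        (mem_of_superset (Icc_mem_nhdsGE (hs.2.trans ht.2)) (Icc_subset_Icc_left hs.1))
    exact ODE_solution_unique_of_mem_Icc_right (s := fun _ ↦ univ) (K := K)
      (fun s hs ↦ (hK s ⟨hs.1, hs.2.le⟩).lipschitzOnWith)
      (hfc.mono hsub) (hder hf) (fun _ _ ↦ mem_univ _) (hgc.mono hsub) (hder hg)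
      (fun _ _ ↦ mem_univ _) h0 ⟨ht.1, le_rfl⟩
  exact key.of_subset_closure hfc hgc Ico_subset_Icc_self (by rw [closure_Ico hT0.ne])

/-- A bounded continuous field which is Lipschitz on every `[0, T]`, `T < 1`, has integral curves
on the closed interval `[0, 1]`. -/
theorem exists_integralCurve_Icc_of_lipschitz_before_one [FiniteDimensional ℝ E] {W : ℝ → E → E}
    (hW : Continuous (Function.uncurry W)) {C : ℝ≥0} (hC : ∀ t x, ‖W t x‖ ≤ C)
    (hL : ∀ T < (1 : ℝ), ∃ K, ∀ t ∈ Icc 0 T, LipschitzWith K (W t)) (a : E) :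
    ∃ f : ℝ → E, f 0 = a ∧
      ∀ t ∈ Icc (0 : ℝ) 1, HasDerivWithinAt f (W t (f t)) (Icc 0 1) t := by
  have : CompleteSpace E := FiniteDimensional.complete ℝ E
  have hex : ∀ T ∈ Ico (0 : ℝ) 1, ∃ f : ℝ → E, f 0 = a ∧
      ∀ t ∈ Icc (0 : ℝ) T, HasDerivWithinAt f (W t (f t)) (Icc 0 T) t := by
    intro T hT
    obtain ⟨K, hK⟩ := hL T hT.2
    have hP : IsPicardLindelof W (⟨0, le_rfl, hT.1⟩ : Icc 0 T) a C 0 C K :=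
      ⟨fun t ht ↦ (hK t ht).lipschitzOnWith, fun x _ ↦ by
        have : Continuous fun t ↦ W t x := hW.comp (by fun_prop : Continuous fun t ↦ (t, x))
        exact this.continuousOn, fun t _ x _ ↦ hC t x, by
        simp only [sub_zero, sub_self, NNReal.coe_zero, max_eq_left hT.1]
        exact mul_le_of_le_one_right C.2 hT.2.le⟩
    exact hP.exists_eq_forall_mem_Icc_hasDerivWithinAt₀
  choose! F hF0 hF using hex
  set γ : ℝ → E := fun t ↦ F ((1 + t) / 2) t with hγ
  have hγF : ∀ T ∈ Ico (0 : ℝ) 1, EqOn γ (F T) (Icc 0 T) := by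
    intro T hT t ht
    have hm : (1 + t) / 2 ∈ Ico (0 : ℝ) 1 :=
      ⟨by linarith [ht.1], by linarith [ht.2, hT.2]⟩
    have hS : min T ((1 + t) / 2) ≤ 1 := (min_le_left _ _).trans hT.2.le
    refine eqOn_Icc_of_lipschitz_before_one hL hS
      (fun s hs ↦ (hF _ hm s ⟨hs.1, hs.2.trans (min_le_right _ _)⟩).mono
        (Icc_subset_Icc_right (min_le_right _ _)))
      (fun s hs ↦ (hF T hT s ⟨hs.1, hs.2.trans (min_le_left _ _)⟩).mono
        (Icc_subset_Icc_right (min_le_left _ _)))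
      (by rw [hF0 _ hm, hF0 T hT]) ⟨ht.1, le_min ht.2 (by linarith [ht.2, hT.2])⟩
  have hγd : ∀ t ∈ Ico (0 : ℝ) 1, HasDerivWithinAt γ (W t (γ t)) (Icc 0 1) t := by
    intro t ht
    have hm : (1 + t) / 2 ∈ Ico (0 : ℝ) 1 := ⟨by linarith [ht.1], by linarith [ht.2]⟩
    have htm : t ∈ Icc 0 ((1 + t) / 2) := ⟨ht.1, by linarith [ht.2]⟩
    have h1 := hF _ hm t htm
    rw [← hγF _ hm htm] at h1
    have h2 : HasDerivWithinAt γ (W t (γ t)) (Icc 0 ((1 + t) / 2)) t :=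
      h1.congr_of_mem (hγF _ hm) htm
    refine h2.mono_of_mem_nhdsWithin ?_
    have : Iio ((1 + t) / 2) ∈ 𝓝[Icc 0 1] t :=
      mem_nhdsWithin_of_mem_nhds (Iio_mem_nhds (by linarith [ht.2]))
    filter_upwards [this, self_mem_nhdsWithin] with s hs hs'
    exact ⟨hs'.1, le_of_lt hs⟩
  have hlip : LipschitzOnWith C γ (Ico 0 1) :=
    (convex_Ico 0 1).lipschitzOnWith_of_nnnorm_hasDerivWithin_le
      (fun t ht ↦ (hγd t ht).mono Ico_subset_Icc_self) (fun t _ ↦ hC t _)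
  obtain ⟨g, hg, hγg⟩ := hlip.extend_finite_dimension
  have hgd : ∀ t ∈ Ico (0 : ℝ) 1, HasDerivWithinAt g (W t (g t)) (Icc 0 1) t := by
    intro t ht
    rw [← hγg ht]
    refine (hγd t ht).congr_of_eventuallyEq ?_ (hγg ht).symm
    have : Iio (1 : ℝ) ∈ 𝓝[Icc 0 1] t := mem_nhdsWithin_of_mem_nhds (Iio_mem_nhds ht.2)
    filter_upwards [this, self_mem_nhdsWithin] with s hs hs'
    exact (hγg ⟨hs'.1, hs⟩).symm
  refine ⟨g, ?_, fun t ht ↦ ?_⟩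
  · rw [← hγg ⟨le_rfl, one_pos⟩]
    exact hF0 _ ⟨by norm_num, by norm_num⟩
  rcases ht.2.lt_or_eq with h | rfl
  · exact hgd t ⟨ht.1, h⟩
  have hgd' : ∀ t ∈ Ioo (0 : ℝ) 1, HasDerivAt g (W t (g t)) t := fun t ht ↦
    (hgd t ⟨ht.1.le, ht.2⟩).hasDerivAt (Icc_mem_nhds ht.1 ht.2)
  have hmem : Ioo (0 : ℝ) 1 ∈ 𝓝[<] 1 := Ioo_mem_nhdsLT one_pos
  refine (hasDerivWithinAt_Iic_of_tendsto_deriv (s := Ioo 0 1)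
    (fun t ht ↦ (hgd' t ht).differentiableAt.differentiableWithinAt)
    hg.continuous.continuousWithinAt hmem ?_).mono Icc_subset_Iic_self
  have hlim : Tendsto (fun t ↦ W t (g t)) (𝓝[<] 1) (𝓝 (W 1 (g 1))) :=
    ((hW.comp (continuous_id.prodMk hg.continuous)).tendsto 1).mono_left nhdsWithin_le_nhds
  refine hlim.congr' ?_
  filter_upwards [hmem] with t ht
  exact (hgd' t ht).deriv.symm

end Flow

/-- Centers of the four quarters of the unit square centered at the origin. -/
def corner : Fin 4 → ℝ × ℝ := ![(-1/4, -1/4), (-1/4, 1/4), (1/4, -1/4), (1/4, 1/4)]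

theorem norm_corner (i : Fin 4) : ‖corner i‖ = 1 / 4 := by
  fin_cases i <;> norm_num [corner, Prod.norm_def]

theorem norm_corner_sub {i j : Fin 4} (hij : i ≠ j) : ‖corner i - corner j‖ = 1 / 2 := by
  fin_cases i <;> fin_cases j <;> first | exact absurd rfl hij | norm_num [corner, Prod.norm_def]

/-- The point with the given address in the planar Cantor set which is made of four copies of
itself scaled by `r`. -/
def cantorPt (r : ℝ) (c : ℕ → Fin 4) : ℝ × ℝ := ∑' j, r ^ j • corner (c j)

section Cantor

variable {r : ℝ}

theorem norm_pow_smul_corner (hr : 0 ≤ r) (i : Fin 4) (j : ℕ) :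
    ‖r ^ j • corner i‖ = r ^ j * (1 / 4) := by
  rw [norm_smul, norm_corner, norm_pow, Real.norm_of_nonneg hr]

theorem summable_pow_smul_corner (hr : 0 ≤ r) (hr1 : r < 1) (c : ℕ → Fin 4) :
    Summable fun j ↦ r ^ j • corner (c j) :=
  .of_norm_bounded ((summable_geometric_of_lt_one hr hr1).mul_right (1 / 4))
    fun _ ↦ (norm_pow_smul_corner hr _ _).le

theorem cantorPt_eq (hr : 0 ≤ r) (hr1 : r < 1) (c : ℕ → Fin 4) :
    cantorPt r c = corner (c 0) + r • cantorPt r fun j ↦ c (j + 1) := by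
  rw [cantorPt, (summable_pow_smul_corner hr hr1 c).tsum_eq_zero_add, cantorPt,
    ← (summable_pow_smul_corner hr hr1 _).tsum_const_smul]
  simp [pow_succ', mul_smul]

theorem norm_cantorPt_le (hr : 0 ≤ r) (hr1 : r < 1) (c : ℕ → Fin 4) :
    ‖cantorPt r c‖ ≤ 1 / (4 * (1 - r)) := by
  have := tsum_of_norm_bounded ((hasSum_geometric_of_lt_one hr hr1).mul_right (1 / 4))
    fun j ↦ (norm_pow_smul_corner hr (c j) j).le
  refine this.trans_eq ?_
  have : 1 - r ≠ 0 := by linarith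
  field_simp

theorem continuous_cantorPt (hr : 0 ≤ r) (hr1 : r < 1) : Continuous (cantorPt r) := by
  refine continuous_tsum (fun j ↦ ?_) ((summable_geometric_of_lt_one hr hr1).mul_right (1 / 4))
    fun j c ↦ (norm_pow_smul_corner hr (c j) j).le
  have : Continuous fun c : ℕ → Fin 4 ↦ corner (c j) :=
    continuous_of_discreteTopology.comp (continuous_apply j)
  exact this.const_smul (r ^ j)

theorem cantorPt_sub_of_eq (hr : 0 ≤ r) (hr1 : r < 1) {c c' : ℕ → Fin 4} {n : ℕ}
    (h : ∀ i < n, c i = c' i) :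
    cantorPt r c - cantorPt r c' =
      r ^ n • (cantorPt r (fun j ↦ c (j + n)) - cantorPt r fun j ↦ c' (j + n)) := by
  induction n with
  | zero => simp
  | succ n ih =>
    rw [ih fun i hi ↦ h i (hi.trans n.lt_succ_self), cantorPt_eq hr hr1 fun j ↦ c (j + n),
      cantorPt_eq hr hr1 fun j ↦ c' (j + n)]
    simp only [zero_add, h n n.lt_succ_self, add_sub_add_left_eq_sub, ← smul_sub, smul_smul,
      ← pow_succ, add_right_comm _ 1 n, add_assoc]

theorem le_norm_cantorPt_sub (hr : 0 ≤ r) (hr1 : r < 1) {c c' : ℕ → Fin 4} {n : ℕ}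
    (h : ∀ i < n, c i = c' i) (hn : c n ≠ c' n) :
    r ^ n * ((1 - 2 * r) / (2 * (1 - r))) ≤ ‖cantorPt r c - cantorPt r c'‖ := by
  rw [cantorPt_sub_of_eq hr hr1 h, norm_smul, norm_pow, Real.norm_of_nonneg hr]
  gcongr
  rw [cantorPt_eq hr hr1 fun j ↦ c (j + n), cantorPt_eq hr hr1 fun j ↦ c' (j + n),
    add_sub_add_comm, ← smul_sub]
  simp only [zero_add]
  set x := cantorPt r fun j ↦ c (j + 1 + n)
  set y := cantorPt r fun j ↦ c' (j + 1 + n)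
  have hx : ‖x‖ ≤ _ := norm_cantorPt_le hr hr1 _
  have hy : ‖y‖ ≤ _ := norm_cantorPt_le hr hr1 _
  have h1 : ‖r • (x - y)‖ ≤ r * (1 / (4 * (1 - r)) + 1 / (4 * (1 - r))) := by
    rw [norm_smul, Real.norm_of_nonneg hr]
    gcongr
    exact (norm_sub_le _ _).trans (add_le_add hx hy)
  have h2 := norm_sub_le_norm_add (corner (c n) - corner (c' n)) (r • (x - y))
  rw [norm_corner_sub hn] at h2
  refine le_trans (le_of_eq ?_) ((sub_le_sub_left h1 _).trans h2)
  have : 1 - r ≠ 0 := by linarith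
  field_simp
  ring

/-- If `4 * r ^ h = 1`, then the Cantor set with scaling ratio `r` has dimension at most `h`. -/
theorem dimH_range_cantorPt_le (hr : 0 < r) (hr1 : r < 1) {h : ℝ≥0} (hh : r ^ (h : ℝ) = 1 / 4) :
    dimH (range (cantorPt r)) ≤ h := by
  apply dimH_le_of_hausdorffMeasure_ne_top
  set D : ℝ := 2 * (1 / (4 * (1 - r))) with hD
  have hD0 : 0 ≤ D := by
    have : 0 < 1 - r := by linarith
    positivity
  let t : (n : ℕ) → (Fin n → Fin 4) → Set (ℝ × ℝ) := fun n p ↦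
    cantorPt r '' {c | ∀ i : Fin n, c i = p i}
  have ht : ∀ n p, Metric.ediam (t n p) ≤ ENNReal.ofReal (r ^ n * D) := by
    rintro n p
    refine Metric.ediam_le ?_
    rintro _ ⟨c, hc, rfl⟩ _ ⟨c', hc', rfl⟩
    rw [edist_dist]
    refine ENNReal.ofReal_le_ofReal ?_
    rw [dist_eq_norm, cantorPt_sub_of_eq hr.le hr1 (n := n)
      (fun i hi ↦ (hc ⟨i, hi⟩).trans (hc' ⟨i, hi⟩).symm), norm_smul, norm_pow,
      Real.norm_of_nonneg hr.le]
    gcongr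
    refine (norm_sub_le _ _).trans ?_
    rw [hD, two_mul]
    exact add_le_add (norm_cantorPt_le hr.le hr1 _) (norm_cantorPt_le hr.le hr1 _)
  have hlim : Tendsto (fun n : ℕ ↦ ENNReal.ofReal (r ^ n * D)) atTop (𝓝 0) := by
    rw [← ENNReal.ofReal_zero, ← zero_mul D]
    exact (ENNReal.continuous_ofReal.tendsto _).comp
      ((tendsto_pow_atTop_nhds_zero_of_lt_one hr.le hr1).mul_const D)
  have hle := Measure.hausdorffMeasure_le_liminf_sum (h : ℝ) (range (cantorPt r)) _ hlim t
    (.of_forall ht) (.of_forall fun n ↦ by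
      rintro _ ⟨c, rfl⟩
      exact mem_iUnion.2 ⟨fun i ↦ c i, c, fun _ ↦ rfl, rfl⟩)
  refine ne_top_of_le_ne_top (b := ENNReal.ofReal (D ^ (h : ℝ))) ENNReal.ofReal_ne_top
    (hle.trans ?_)
  refine (liminf_le_liminf (v := fun _ ↦ ENNReal.ofReal (D ^ (h : ℝ)))
    (.of_forall fun n ↦ ?_)).trans_eq (liminf_const _)
  calc ∑ p, Metric.ediam (t n p) ^ (h : ℝ)
      ≤ ∑ _p : Fin n → Fin 4, ENNReal.ofReal (r ^ n * D) ^ (h : ℝ) := by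
        gcongr with p
        exact ht n p
    _ = ENNReal.ofReal (D ^ (h : ℝ)) := by
        rw [ENNReal.ofReal_rpow_of_nonneg (by positivity) h.coe_nonneg, Finset.sum_const, nsmul_eq_mul,
          Real.mul_rpow (by positivity) hD0, ← Real.rpow_pow_comm hr.le, hh,
          ENNReal.ofReal_mul (by positivity), ← mul_assoc]
        have : ((Finset.univ : Finset (Fin n → Fin 4)).card : ℝ≥0∞) *
            ENNReal.ofReal ((1 / 4) ^ n) = 1 := by
          rw [← ENNReal.ofReal_natCast, ← ENNReal.ofReal_mul (by positivity)]
          simp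
        rw [this, one_mul]

/-- If `4 * r ^ h = 1`, then the Cantor set with scaling ratio `r` has dimension at least `h`. -/
theorem le_dimH_range_cantorPt (hr : 0 < r) (hr2 : r < 1 / 2) {h : ℝ≥0} (h0 : 0 < h)
    (hh : r ^ (h : ℝ) = 1 / 4) : h ≤ dimH (range (cantorPt r)) := by
  have hr1 : r < 1 := by linarith
  set δ : ℝ := (1 - 2 * r) / (2 * (1 - r)) with hδ
  have hδ0 : 0 < δ := div_pos (by linarith) (by linarith)
  have key : ∀ c c' : ℕ → Fin 4, |Real.ofDigits c - Real.ofDigits c'| ≤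
      (δ ^ (h : ℝ))⁻¹ * ‖cantorPt r c - cantorPt r c'‖ ^ (h : ℝ) := by
    intro c c'
    rcases eq_or_ne c c' with rfl | hne
    · simp only [sub_self, abs_zero]
      positivity
    set n := PiNat.firstDiff c c'
    have hlt : ∀ i < n, c i = c' i := fun i hi ↦ PiNat.apply_eq_of_lt_firstDiff hi
    refine (Real.abs_ofDigits_sub_ofDigits_le hlt).trans ?_
    rw [← div_eq_inv_mul, le_div_iff₀ (by positivity)]
    calc ((4 : ℕ) ^ n : ℝ)⁻¹ * δ ^ (h : ℝ) = (r ^ n * δ) ^ (h : ℝ) := by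
          rw [Real.mul_rpow (by positivity) hδ0.le, ← Real.rpow_pow_comm hr.le, hh]
          push_cast
          rw [one_div, inv_pow]
      _ ≤ _ := by
          gcongr
          exact le_norm_cantorPt_sub hr.le hr1 hlt (PiNat.apply_firstDiff_ne hne)
  set f : ℝ × ℝ → ℝ := fun x ↦ Real.ofDigits (Function.invFun (cantorPt r) x)
  have hf : HolderOnWith (Real.toNNReal (δ ^ (h : ℝ))⁻¹) h f (range (cantorPt r)) := by
    intro x hx y hy
    have := key (Function.invFun (cantorPt r) x) (Function.invFun (cantorPt r) y)
    rw [Function.invFun_eq hx, Function.invFun_eq hy] at this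
    rw [edist_dist, edist_dist, ENNReal.ofReal_rpow_of_nonneg dist_nonneg h.coe_nonneg, ← ENNReal.ofReal,
      ← ENNReal.ofReal_mul (by positivity)]
    exact ENNReal.ofReal_le_ofReal (by rwa [Real.dist_eq, dist_eq_norm])
  have himg : Icc (0 : ℝ) 1 ⊆ f '' range (cantorPt r) := by
    intro y hy
    obtain ⟨c, -, rfl⟩ := Real.ofDigits_SurjOn (b := 4) (by norm_num) hy
    refine ⟨_, ⟨c, rfl⟩, ?_⟩
    have := key (Function.invFun (cantorPt r) (cantorPt r c)) c
    rw [Function.invFun_eq (f := cantorPt r) ⟨c, rfl⟩, sub_self, norm_zero, Real.zero_rpow (by positivity),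
      mul_zero] at this
    exact sub_eq_zero.1 (abs_nonpos_iff.1 this)
  have h1 : (1 : ℝ≥0∞) = dimH (Icc (0 : ℝ) 1) := by
    rw [Real.dimH_of_nonempty_interior (by simp)]
    simp
  have h2 := (h1.le.trans (dimH_mono himg)).trans (hf.dimH_image_le h0)
  rwa [ENNReal.le_div_iff_mul_le (by simp [h0.ne']) (by simp), one_mul] at h2

theorem dimH_range_cantorPt (hr : 0 < r) (hr2 : r < 1 / 2) {h : ℝ} (h0 : 0 < h)
    (hh : r ^ h = 1 / 4) : dimH (range (cantorPt r)) = ENNReal.ofReal h := by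
  lift h to ℝ≥0 using h0.le
  rw [ENNReal.ofReal_coe_nnreal]
  exact (dimH_range_cantorPt_le hr (by linarith) hh).antisymm
    (le_dimH_range_cantorPt hr hr2 (mod_cast h0) hh)

end Cantor

/-- Superposition of weighted copies of `f` centered at the `2 ^ (n + 1)` half-integers closest
to `0`. -/
def gridSum (n : ℕ) (w : ℤ → ℝ) (f : ℝ → ℝ) (x : ℝ) : ℝ :=
  ∑ k ∈ Finset.Ico (-2 ^ n : ℤ) (2 ^ n), w k * f (x - (k + 1 / 2))

section Grid

variable {f : ℝ → ℝ} {n : ℕ} {w : ℤ → ℝ} {x : ℝ}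

theorem gridSum_eq_floor (hf : ∀ y, 1 / 2 ≤ |y| → f y = 0) :
    gridSum n w f x = if ⌊x⌋ ∈ Finset.Ico (-2 ^ n : ℤ) (2 ^ n) then
      w ⌊x⌋ * f (x - (⌊x⌋ + 1 / 2)) else 0 := by
  have h0 : ∀ k : ℤ, k ≠ ⌊x⌋ → w k * f (x - (k + 1 / 2)) = 0 := by
    intro k hk
    rw [hf, mul_zero]
    by_contra! h
    rw [abs_lt] at h
    exact hk (Int.floor_eq_iff.2 ⟨by linarith, by linarith⟩).symm
  split_ifs with h
  · exact Finset.sum_eq_single_of_mem _ h fun k _ hk ↦ h0 k hk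
  · exact Finset.sum_eq_zero fun k hk ↦ h0 k fun hk' ↦ h (hk' ▸ hk)

theorem gridSum_of_abs_sub_lt (hf : ∀ y, 1 / 2 ≤ |y| → f y = 0) {k : ℤ}
    (hk : k ∈ Ico (-2 ^ n : ℤ) (2 ^ n)) (hx : |x - (k + 1 / 2)| < 1 / 2) :
    gridSum n w f x = w k * f (x - (k + 1 / 2)) := by
  rw [abs_lt] at hx
  have : ⌊x⌋ = k := Int.floor_eq_iff.2 ⟨by linarith, by linarith⟩
  rw [gridSum_eq_floor hf, this, if_pos (by simpa using hk)]

theorem abs_gridSum_le (hf : ∀ y, 1 / 2 ≤ |y| → f y = 0) {A B : ℝ} (hA : 0 ≤ A) (hB : 0 ≤ B)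
    (hw : ∀ k ∈ Ico (-2 ^ n : ℤ) (2 ^ n), |w k| ≤ A) (hfB : ∀ y, |f y| ≤ B) :
    |gridSum n w f x| ≤ A * B := by
  rw [gridSum_eq_floor hf]
  split_ifs with h
  · rw [abs_mul]
    exact mul_le_mul (hw _ (by simpa using h)) (hfB _) (abs_nonneg _) hA
  · simpa using mul_nonneg hA hB

theorem gridSum_eq_zero (hf : ∀ y, 1 / 2 ≤ |y| → f y = 0) (hx : 2 ^ n < |x|) :
    gridSum n w f x = 0 := by
  rw [gridSum_eq_floor hf, if_neg]
  rw [Finset.mem_Ico, Int.le_floor, Int.floor_lt]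
  push_cast
  rintro ⟨h1, h2⟩
  exact hx.not_ge (abs_le.2 ⟨h1, h2.le⟩)

theorem ContDiff.gridSum {m : WithTop ℕ∞} (hf : ContDiff ℝ m f) :
    ContDiff ℝ m (gridSum n w f) := by
  unfold _root_.gridSum
  fun_prop

theorem hasDerivAt_gridSum (hf : Differentiable ℝ f) :
    HasDerivAt (gridSum n w f) (gridSum n w (deriv f) x) x := by
  unfold gridSum
  refine HasDerivAt.fun_sum fun k _ ↦ ?_
  exact ((hf _).hasDerivAt.comp_sub_const x _).const_mul _

end Grid

/-- A divergence free field which is constant near each half-integer point of the square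
`[-2 ^ n, 2 ^ n] ^ 2`, with the position of that point as its value. -/
theorem exists_gridField {a : ℝ} (ha : 0 < a) (ha2 : a < 1 / 2) :
    ∃ (F : ℕ → ℝ × ℝ → ℝ × ℝ) (M : ℝ), (∀ n, ContDiff ℝ 1 (F n)) ∧
      (∀ n z, ‖F n z‖ ≤ M * 2 ^ n) ∧
      (∀ n z, 2 ^ n < ‖z‖ → F n z = 0) ∧
      (∀ n z, fderiv ℝ (fun y ↦ (F n y).1) z (1, 0) + fderiv ℝ (fun y ↦ (F n y).2) z (0, 1) = 0) ∧
      ∀ n, ∀ k ∈ Ico (-2 ^ n : ℤ) (2 ^ n), ∀ l ∈ Ico (-2 ^ n : ℤ) (2 ^ n), ∀ z : ℝ × ℝ,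
        ‖z - ((k : ℝ) + 1 / 2, (l : ℝ) + 1 / 2)‖ ≤ a →
        F n z = ((k : ℝ) + 1 / 2, (l : ℝ) + 1 / 2) := by
  let η : ContDiffBump (0 : ℝ) := ⟨a, 1 / 2, ha, ha2⟩
  let ζ : ℝ → ℝ := fun y ↦ y * η y
  have hη : ContDiff ℝ ∞ η := η.contDiff
  have hζ : ContDiff ℝ ∞ ζ := contDiff_id.mul hη
  have hη' : ContDiff ℝ ∞ (deriv η) := (contDiff_infty_iff_deriv.1 hη).2
  have hζ' : ContDiff ℝ ∞ (deriv ζ) := (contDiff_infty_iff_deriv.1 hζ).2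
  have hζη : ∀ y, deriv ζ y = η y + y * deriv η y := fun y ↦ by
    have := (hasDerivAt_id y).mul ((hη.differentiable (by simp)) y).hasDerivAt
    exact this.deriv.trans (by simp)
  have hη0 : ∀ y, 1 / 2 ≤ |y| → η y = 0 := fun y hy ↦
    η.zero_of_le_dist (by rwa [Real.dist_eq, sub_zero])
  have hη1 : ∀ y, |y| ≤ a → η y = 1 := fun y hy ↦
    η.one_of_mem_closedBall (by simpa using hy)
  have hη0' : ∀ y, 1 / 2 ≤ |y| → deriv η y = 0 := fun y hy ↦
    IsLocalMin.deriv_eq_zero (.of_forall fun u ↦ by rw [hη0 y hy]; exact η.nonneg)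
  have hη1' : ∀ y, |y| ≤ a → deriv η y = 0 := fun y hy ↦
    IsLocalMax.deriv_eq_zero (.of_forall fun u ↦ by rw [hη1 y hy]; exact η.le_one)
  have hζ0 : ∀ y, 1 / 2 ≤ |y| → ζ y = 0 := fun y hy ↦ by simp [ζ, hη0 y hy]
  have hζ0' : ∀ y, 1 / 2 ≤ |y| → deriv ζ y = 0 := fun y hy ↦ by simp [hζη, hη0 y hy, hη0' y hy]
  have hbd : ∀ {f : ℝ → ℝ}, Continuous f → (∀ y, 1 / 2 ≤ |y| → f y = 0) →
      ∃ B, 0 ≤ B ∧ ∀ y, |f y| ≤ B := by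
    intro f hf h0
    obtain ⟨B, hB⟩ := (isCompact_Icc (a := -(1 / 2 : ℝ)) (b := 1 / 2)).exists_bound_of_continuousOn
      hf.continuousOn
    refine ⟨max B 0, le_max_right _ _, fun y ↦ ?_⟩
    rcases le_total (1 / 2) |y| with h | h
    · simp [h0 y h]
    · exact (hB y (abs_le.1 h)).trans (le_max_left _ _)
  obtain ⟨B₁, hB₁, hB₁'⟩ := hbd hη.continuous hη0
  obtain ⟨B₂, hB₂, hB₂'⟩ := hbd hη'.continuous hη0'
  obtain ⟨B₃, hB₃, hB₃'⟩ := hbd hζ.continuous hζ0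
  obtain ⟨B₄, hB₄, hB₄'⟩ := hbd hζ'.continuous hζ0'
  let w : ℤ → ℝ := fun k ↦ k + 1 / 2
  let v : ℤ → ℝ := fun _ ↦ 1
  have hw : ∀ n, ∀ k ∈ Ico (-2 ^ n : ℤ) (2 ^ n), |w k| ≤ 2 ^ n := by
    intro n k hk
    have h1 : (-2 ^ n : ℝ) ≤ k := mod_cast hk.1
    have h2 : (k : ℝ) + 1 ≤ 2 ^ n := mod_cast hk.2
    exact abs_le.2 ⟨by simp only [w]; linarith, by simp only [w]; linarith⟩
  have hv : ∀ n, ∀ k ∈ Ico (-2 ^ n : ℤ) (2 ^ n), |v k| ≤ 1 := by simp [v]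
  let F : ℕ → ℝ × ℝ → ℝ × ℝ := fun n z ↦
    (gridSum n w η z.1 * gridSum n v (deriv ζ) z.2 - gridSum n v ζ z.1 * gridSum n w (deriv η) z.2,
      gridSum n v (deriv ζ) z.1 * gridSum n w η z.2 -
        gridSum n w (deriv η) z.1 * gridSum n v ζ z.2)
  refine ⟨F, B₁ * B₄ + B₃ * B₂, fun n ↦ ?_, fun n z ↦ ?_, fun n z hz ↦ ?_, fun n z ↦ ?_,
    fun n k hk l hl z hz ↦ ?_⟩
  · have h1 : ContDiff ℝ 1 (gridSum n w η) := (hη.of_le (by simp)).gridSum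
    have h2 : ContDiff ℝ 1 (gridSum n w (deriv η)) := (hη'.of_le (by simp)).gridSum
    have h3 : ContDiff ℝ 1 (gridSum n v ζ) := (hζ.of_le (by simp)).gridSum
    have h4 : ContDiff ℝ 1 (gridSum n v (deriv ζ)) := (hζ'.of_le (by simp)).gridSum
    fun_prop
  · have h2n : (0 : ℝ) ≤ 2 ^ n := by positivity
    have h1 := fun x ↦ abs_gridSum_le (x := x) hη0 h2n hB₁ (hw n) hB₁'
    have h2 := fun x ↦ abs_gridSum_le (x := x) hη0' h2n hB₂ (hw n) hB₂'
    have h3 := fun x ↦ abs_gridSum_le (x := x) hζ0 zero_le_one hB₃ (hv n) hB₃'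
    have h4 := fun x ↦ abs_gridSum_le (x := x) hζ0' zero_le_one hB₄ (hv n) hB₄'
    refine max_le ?_ ?_
    · refine (abs_sub _ _).trans ?_
      rw [abs_mul, abs_mul]
      calc _ ≤ (2 ^ n * B₁) * (1 * B₄) + (1 * B₃) * (2 ^ n * B₂) := by
            gcongr <;> apply_rules
        _ = _ := by ring
    · refine (abs_sub _ _).trans ?_
      rw [abs_mul, abs_mul]
      calc _ ≤ (1 * B₄) * (2 ^ n * B₁) + (2 ^ n * B₂) * (1 * B₃) := by
            gcongr <;> apply_rules
        _ = _ := by ring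
  · rcases lt_max_iff.1 hz with h | h
    · simp only [F, gridSum_eq_zero hη0 h, gridSum_eq_zero hη0' h, gridSum_eq_zero hζ0 h,
        gridSum_eq_zero hζ0' h, zero_mul, sub_zero, Prod.mk_zero_zero]
    · simp only [F, gridSum_eq_zero hη0 h, gridSum_eq_zero hη0' h, gridSum_eq_zero hζ0 h,
        gridSum_eq_zero hζ0' h, mul_zero, sub_zero, Prod.mk_zero_zero]
  · have hfst : ∀ {f : ℝ → ℝ} (u : ℤ → ℝ), ContDiff ℝ ∞ f → HasFDerivAt
        (fun y : ℝ × ℝ ↦ gridSum n u f y.1)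
        (gridSum n u (deriv f) z.1 • ContinuousLinearMap.fst ℝ ℝ ℝ) z := fun u hf ↦
      (hasDerivAt_gridSum (hf.differentiable (by simp))).comp_hasFDerivAt z hasFDerivAt_fst
    have hsnd : ∀ {f : ℝ → ℝ} (u : ℤ → ℝ), ContDiff ℝ ∞ f → HasFDerivAt
        (fun y : ℝ × ℝ ↦ gridSum n u f y.2)
        (gridSum n u (deriv f) z.2 • ContinuousLinearMap.snd ℝ ℝ ℝ) z := fun u hf ↦
      (hasDerivAt_gridSum (hf.differentiable (by simp))).comp_hasFDerivAt z hasFDerivAt_snd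
    have e1 := (((hfst w hη).mul (hsnd v hζ')).sub ((hfst v hζ).mul (hsnd w hη'))).fderiv
    have e2 := (((hfst v hζ').mul (hsnd w hη)).sub ((hfst w hη').mul (hsnd v hζ))).fderiv
    erw [e1, e2]
    simp
    ring
  · have h1 : |z.1 - (k + 1 / 2)| ≤ a := (le_max_left _ _).trans hz
    have h2 : |z.2 - (l + 1 / 2)| ≤ a := (le_max_right _ _).trans hz
    have g1 := h1.trans_lt ha2
    have g2 := h2.trans_lt ha2
    simp only [F, gridSum_of_abs_sub_lt hη0 hk g1, gridSum_of_abs_sub_lt hη0 hl g2,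
      gridSum_of_abs_sub_lt hη0' hk g1, gridSum_of_abs_sub_lt hη0' hl g2,
      gridSum_of_abs_sub_lt hζ0 hk g1, gridSum_of_abs_sub_lt hζ0 hl g2,
      gridSum_of_abs_sub_lt hζ0' hk g1, gridSum_of_abs_sub_lt hζ0' hl g2,
      hζη, hη1 _ h1, hη1 _ h2, hη1' _ h1, hη1' _ h2]
    simp [v, w]

theorem integral_dot2_grad2_eq_zero {u : ℝ × ℝ → ℝ × ℝ} (hu : ContDiff ℝ 1 u)
    (hdiv : ∀ x, fderiv ℝ (fun y ↦ (u y).1) x (1, 0) + fderiv ℝ (fun y ↦ (u y).2) x (0, 1) = 0)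
    {ψ : ℝ × ℝ → ℝ} (hψ : ContDiff ℝ 1 ψ) (hc : HasCompactSupport ψ) :
    ∫ x, dot2 (u x) (grad2 ψ x) = 0 := by
  have hint : ∀ {g : ℝ × ℝ → ℝ}, ContDiff ℝ 1 g → ∀ v,
      Integrable (fun x ↦ g x * fderiv ℝ ψ x v) ∧ Integrable (fun x ↦ fderiv ℝ g x v * ψ x) ∧
      ∫ x, g x * fderiv ℝ ψ x v = -∫ x, fderiv ℝ g x v * ψ x := by
    intro g hg v
    have hg' : Continuous fun x ↦ fderiv ℝ g x v := (hg.continuous_fderiv (by simp)).clm_apply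
      continuous_const
    have hψ' : Continuous fun x ↦ fderiv ℝ ψ x v := (hψ.continuous_fderiv (by simp)).clm_apply
      continuous_const
    have i1 : Integrable (fun x ↦ g x * fderiv ℝ ψ x v) :=
      (hg.continuous.mul hψ').integrable_of_hasCompactSupport (hc.fderiv_apply (𝕜 := ℝ) v).mul_left
    have i2 : Integrable (fun x ↦ fderiv ℝ g x v * ψ x) :=
      (hg'.mul hψ.continuous).integrable_of_hasCompactSupport hc.mul_left
    have i3 : Integrable (fun x ↦ g x * ψ x) :=
      (hg.continuous.mul hψ.continuous).integrable_of_hasCompactSupport hc.mul_left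
    exact ⟨i1, i2, integral_mul_fderiv_eq_neg_fderiv_mul_of_integrable i2 i1 i3
      (fun x _ ↦ hg.differentiable (by simp) x) (fun x _ ↦ hψ.differentiable (by simp) x)⟩
  obtain ⟨a1, a2, a3⟩ := hint hu.fst (1, 0)
  obtain ⟨b1, b2, b3⟩ := hint hu.snd (0, 1)
  simp only [dot2, grad2]
  rw [integral_add a1 b1, a3, b3, ← neg_add, ← integral_add a2 b2]
  simp [← add_mul, hdiv]

theorem divergence_const_smul_comp_smul {u : ℝ × ℝ → ℝ × ℝ} (hu : ContDiff ℝ 1 u) (c s : ℝ)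
    (hdiv : ∀ x, fderiv ℝ (fun y ↦ (u y).1) x (1, 0) + fderiv ℝ (fun y ↦ (u y).2) x (0, 1) = 0)
    (x : ℝ × ℝ) :
    fderiv ℝ (fun y ↦ (c • u (s • y)).1) x (1, 0) +
      fderiv ℝ (fun y ↦ (c • u (s • y)).2) x (0, 1) = 0 := by
  have key : ∀ {g : ℝ × ℝ → ℝ}, ContDiff ℝ 1 g → ∀ v,
      fderiv ℝ (fun y ↦ c • g (s • y)) x v = c * s * fderiv ℝ g (s • x) v := by
    intro g hg v
    have h1 : HasFDerivAt (fun y : ℝ × ℝ ↦ s • y) (s • ContinuousLinearMap.id ℝ (ℝ × ℝ)) x :=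
      (hasFDerivAt_id x).const_smul s
    have h2 := (((hg.differentiable (by simp)) (s • x)).hasFDerivAt.comp x h1).const_smul c
    have h3 := congrArg (fun L : ℝ × ℝ →L[ℝ] ℝ ↦ L v) h2.fderiv
    refine Eq.trans h3 ?_
    simp [mul_assoc]
  simp only [Prod.smul_fst, Prod.smul_snd]
  rw [key hu.fst, key hu.snd, ← mul_add, hdiv, mul_zero]

section Timing

variable {r q : ℝ}

/-- A smooth switch going from `0` to `1` on the interval `[1 - q ^ n, 1 - q ^ (n + 1)]`. -/
def ramp (q : ℝ) (n : ℕ) (t : ℝ) : ℝ :=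
  Real.smoothTransition ((t - (1 - q ^ n)) / ((1 - q) * q ^ n))

/-- The derivative of `ramp q n`. -/
def rampDeriv (q : ℝ) (n : ℕ) (t : ℝ) : ℝ :=
  deriv Real.smoothTransition ((t - (1 - q ^ n)) / ((1 - q) * q ^ n)) / ((1 - q) * q ^ n)

theorem ramp_eq_zero (hq : 0 < q) (hq1 : q < 1) {n : ℕ} {t : ℝ} (ht : t ≤ 1 - q ^ n) :
    ramp q n t = 0 :=
  Real.smoothTransition.zero_of_nonpos <| div_nonpos_of_nonpos_of_nonneg (by linarith)
    (mul_nonneg (by linarith) (by positivity))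

theorem ramp_eq_one (hq : 0 < q) (hq1 : q < 1) {n : ℕ} {t : ℝ} (ht : 1 - q ^ (n + 1) ≤ t) :
    ramp q n t = 1 := by
  refine Real.smoothTransition.one_of_one_le ?_
  rw [one_le_div (mul_pos (by linarith) (by positivity))]
  rw [pow_succ] at ht
  linarith

theorem ramp_nonneg (q : ℝ) (n : ℕ) (t : ℝ) : 0 ≤ ramp q n t := Real.smoothTransition.nonneg _

theorem ramp_le_one (q : ℝ) (n : ℕ) (t : ℝ) : ramp q n t ≤ 1 := Real.smoothTransition.le_one _

theorem hasDerivAt_ramp (q : ℝ) (n : ℕ) (t : ℝ) : HasDerivAt (ramp q n) (rampDeriv q n t) t := by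
  have h1 : HasDerivAt (fun t ↦ (t - (1 - q ^ n)) / ((1 - q) * q ^ n)) (1 / ((1 - q) * q ^ n)) t :=
    ((hasDerivAt_id t).sub_const _).div_const _
  have h2 := ((Real.smoothTransition.contDiff (n := 1)).differentiable (by simp)
    ((t - (1 - q ^ n)) / ((1 - q) * q ^ n))).hasDerivAt.comp t h1
  rwa [mul_one_div] at h2

theorem deriv_smoothTransition_of_nonpos {u : ℝ} (hu : u ≤ 0) :
    deriv Real.smoothTransition u = 0 := by
  refine IsLocalMin.deriv_eq_zero (Eventually.of_forall fun x ↦ ?_)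
  rw [Real.smoothTransition.zero_of_nonpos hu]
  exact Real.smoothTransition.nonneg x

theorem deriv_smoothTransition_of_one_le {u : ℝ} (hu : 1 ≤ u) :
    deriv Real.smoothTransition u = 0 := by
  refine IsLocalMax.deriv_eq_zero (Eventually.of_forall fun x ↦ ?_)
  rw [Real.smoothTransition.one_of_one_le hu]
  exact Real.smoothTransition.le_one x

theorem continuous_deriv_smoothTransition : Continuous (deriv Real.smoothTransition) :=
  (Real.smoothTransition.contDiff (n := 1)).continuous_deriv (by simp)

theorem exists_abs_deriv_smoothTransition_le :
    ∃ L, 0 ≤ L ∧ ∀ u, |deriv Real.smoothTransition u| ≤ L := by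
  obtain ⟨L, hL⟩ := isCompact_Icc.exists_bound_of_continuousOn (s := Icc (0 : ℝ) 1)
    continuous_deriv_smoothTransition.continuousOn
  have hL0 : 0 ≤ L := (abs_nonneg _).trans (hL 0 (by simp))
  refine ⟨L, hL0, fun u ↦ ?_⟩
  rcases le_total u 0 with h | h
  · simpa [deriv_smoothTransition_of_nonpos h]
  rcases le_total 1 u with h' | h'
  · simpa [deriv_smoothTransition_of_one_le h']
  exact hL u ⟨h, h'⟩

theorem continuous_rampDeriv (q : ℝ) (n : ℕ) : Continuous (rampDeriv q n) :=
  (continuous_deriv_smoothTransition.comp (by fun_prop)).div_const _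

theorem rampDeriv_of_le (hq : 0 < q) (hq1 : q < 1) {n : ℕ} {t : ℝ} (ht : t ≤ 1 - q ^ n) :
    rampDeriv q n t = 0 := by
  rw [rampDeriv, deriv_smoothTransition_of_nonpos, zero_div]
  exact div_nonpos_of_nonpos_of_nonneg (by linarith) (mul_nonneg (by linarith) (by positivity))

theorem rampDeriv_of_ge (hq : 0 < q) (hq1 : q < 1) {n : ℕ} {t : ℝ} (ht : 1 - q ^ (n + 1) ≤ t) :
    rampDeriv q n t = 0 := by
  rw [rampDeriv, deriv_smoothTransition_of_one_le, zero_div]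
  rw [one_le_div (mul_pos (by linarith) (by positivity))]
  rw [pow_succ] at ht
  linarith

theorem mem_Ioo_of_rampDeriv_ne_zero (hq : 0 < q) (hq1 : q < 1) {n : ℕ} {t : ℝ}
    (ht : rampDeriv q n t ≠ 0) : t ∈ Ioo (1 - q ^ n) (1 - q ^ (n + 1)) :=
  ⟨lt_of_not_ge fun h ↦ ht (rampDeriv_of_le hq hq1 h),
    lt_of_not_ge fun h ↦ ht (rampDeriv_of_ge hq hq1 h)⟩

theorem exists_abs_rampDeriv_le (hq : 0 < q) (hq1 : q < 1) :
    ∃ L, 0 ≤ L ∧ ∀ n t, |rampDeriv q n t| ≤ L / q ^ n := by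
  obtain ⟨L, hL0, hL⟩ := exists_abs_deriv_smoothTransition_le
  refine ⟨L / (1 - q), div_nonneg hL0 (by linarith), fun n t ↦ ?_⟩
  have h1 : 0 < (1 - q) * q ^ n := mul_pos (by linarith) (by positivity)
  rw [rampDeriv, abs_div, abs_of_pos h1, div_div]
  gcongr
  exact hL _

/-- Half the mesh of the `n`-th contraction at time `t`, shrinking from `r ^ n / 2` to
`r ^ (n + 1)`. -/
def scale (r q : ℝ) (n : ℕ) (t : ℝ) : ℝ := r ^ n / 2 - r ^ n * (1 / 2 - r) * ramp q n t

/-- The derivative of `scale r q n`. -/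
def scaleDeriv (r q : ℝ) (n : ℕ) (t : ℝ) : ℝ := -(r ^ n * (1 / 2 - r) * rampDeriv q n t)

theorem pow_succ_le_scale (hr : 0 < r) (hr2 : r < 1 / 2) (q : ℝ) (n : ℕ) (t : ℝ) :
    r ^ (n + 1) ≤ scale r q n t := by
  have h1 := mul_le_mul_of_nonneg_left (ramp_le_one q n t)
    (mul_nonneg (pow_nonneg hr.le n) (by linarith : 0 ≤ 1 / 2 - r))
  rw [scale, pow_succ]
  linarith

theorem scale_pos (hr : 0 < r) (hr2 : r < 1 / 2) (q : ℝ) (n : ℕ) (t : ℝ) : 0 < scale r q n t :=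
  (pow_pos hr _).trans_le (pow_succ_le_scale hr hr2 q n t)

theorem scale_le (hr : 0 < r) (hr2 : r < 1 / 2) (q : ℝ) (n : ℕ) (t : ℝ) :
    scale r q n t ≤ r ^ n / 2 := by
  have h1 := mul_nonneg (mul_nonneg (pow_nonneg hr.le n) (by linarith : 0 ≤ 1 / 2 - r))
    (ramp_nonneg q n t)
  rw [scale]
  linarith

theorem continuous_scale (r q : ℝ) (n : ℕ) : Continuous (scale r q n) :=
  continuous_const.sub (continuous_const.mul
    (continuous_iff_continuousAt.2 fun t ↦ (hasDerivAt_ramp q n t).continuousAt))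

theorem continuous_scaleDeriv (r q : ℝ) (n : ℕ) : Continuous (scaleDeriv r q n) :=
  (continuous_const.mul (continuous_rampDeriv q n)).neg

theorem scaleDeriv_of_le (hq : 0 < q) (hq1 : q < 1) {n : ℕ} {t : ℝ} (ht : t ≤ 1 - q ^ n) :
    scaleDeriv r q n t = 0 := by
  simp [scaleDeriv, rampDeriv_of_le hq hq1 ht]

theorem mem_Ioo_of_scaleDeriv_ne_zero (hq : 0 < q) (hq1 : q < 1) {n : ℕ} {t : ℝ}
    (ht : scaleDeriv r q n t ≠ 0) : t ∈ Ioo (1 - q ^ n) (1 - q ^ (n + 1)) :=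
  mem_Ioo_of_rampDeriv_ne_zero hq hq1 fun h ↦ ht (by simp [scaleDeriv, h])

theorem le_of_mem_Ioo_of_mem_Ioo (hq : 0 < q) (hq1 : q < 1) {m n : ℕ} {t : ℝ}
    (hm : t ∈ Ioo (1 - q ^ m) (1 - q ^ (m + 1))) (hn : t ∈ Ioo (1 - q ^ n) (1 - q ^ (n + 1))) :
    m ≤ n := by
  by_contra! h
  have := pow_le_pow_of_le_one hq.le hq1.le (show n + 1 ≤ m from h)
  linarith [hm.1, hn.2]

theorem scaleDeriv_eq_zero_of_ne (hq : 0 < q) (hq1 : q < 1) {m n : ℕ} {t : ℝ}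
    (hn : scaleDeriv r q n t ≠ 0) (hmn : m ≠ n) : scaleDeriv r q m t = 0 := by
  by_contra hm
  have h1 := mem_Ioo_of_scaleDeriv_ne_zero hq hq1 hm
  have h2 := mem_Ioo_of_scaleDeriv_ne_zero hq hq1 hn
  exact hmn (le_antisymm (le_of_mem_Ioo_of_mem_Ioo hq hq1 h1 h2)
    (le_of_mem_Ioo_of_mem_Ioo hq hq1 h2 h1))

theorem exists_abs_scaleDeriv_le (hr : 0 < r) (hr2 : r < 1 / 2) (hq : 0 < q) (hq1 : q < 1) :
    ∃ L, 0 ≤ L ∧ ∀ n t, |scaleDeriv r q n t| ≤ L * (r / q) ^ n := by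
  obtain ⟨L, hL0, hL⟩ := exists_abs_rampDeriv_le hq hq1
  refine ⟨L, hL0, fun n t ↦ ?_⟩
  have h1 : 0 ≤ r ^ n * (1 / 2 - r) := mul_nonneg (by positivity) (by linarith)
  rw [scaleDeriv, abs_neg, abs_mul, abs_of_nonneg h1]
  calc r ^ n * (1 / 2 - r) * |rampDeriv q n t| ≤ r ^ n * 1 * (L / q ^ n) := by
        gcongr
        · linarith
        · exact hL n t
    _ = L * (r / q) ^ n := by rw [div_pow]; ring

end Timing

section Velocity

/-- The velocity field obtained by running the stationary fields `F n` one after the other, at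
spatial scale `scale r q n`. -/
def velocity (r q : ℝ) (F : ℕ → ℝ × ℝ → ℝ × ℝ) (t : ℝ) (x : ℝ × ℝ) : ℝ × ℝ :=
  ∑' n, scaleDeriv r q n t • F n ((scale r q n t)⁻¹ • x)

variable {r q M : ℝ} {F : ℕ → ℝ × ℝ → ℝ × ℝ}

theorem velocity_eq_of_scaleDeriv_ne_zero (hq : 0 < q) (hq1 : q < 1) {n : ℕ} {t : ℝ}
    (hn : scaleDeriv r q n t ≠ 0) (x : ℝ × ℝ) :
    velocity r q F t x = scaleDeriv r q n t • F n ((scale r q n t)⁻¹ • x) :=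
  tsum_eq_single n fun m hm ↦ by rw [scaleDeriv_eq_zero_of_ne hq hq1 hn hm, zero_smul]

theorem velocity_eq_zero {t : ℝ} (ht : ∀ n, scaleDeriv r q n t = 0) (x : ℝ × ℝ) :
    velocity r q F t x = 0 := by
  simp [velocity, ht]

theorem exists_summable_bound (hr : 0 < r) (hr2 : r < 1 / 2) (hq : 2 * r < q) (hq1 : q < 1)
    (hM : ∀ n z, ‖F n z‖ ≤ M * 2 ^ n) :
    ∃ u : ℕ → ℝ, Summable u ∧ ∀ n t z, ‖scaleDeriv r q n t • F n z‖ ≤ u n := by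
  have hq0 : 0 < q := by linarith
  obtain ⟨L, hL0, hL⟩ := exists_abs_scaleDeriv_le hr hr2 hq0 hq1
  refine ⟨fun n ↦ L * M * (2 * r / q) ^ n, (summable_geometric_of_lt_one (by positivity)
    ((div_lt_one hq0).2 hq)).mul_left _, fun n t z ↦ ?_⟩
  rw [norm_smul, Real.norm_eq_abs]
  calc |scaleDeriv r q n t| * ‖F n z‖ ≤ L * (r / q) ^ n * (M * 2 ^ n) := by
        gcongr
        · exact hL n t
        · exact hM n z
    _ = L * M * (2 * r / q) ^ n := by rw [div_pow, div_pow, mul_pow]; ring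

theorem continuous_velocity (hr : 0 < r) (hr2 : r < 1 / 2) (hq : 2 * r < q) (hq1 : q < 1)
    (hF : ∀ n, Continuous (F n)) (hM : ∀ n z, ‖F n z‖ ≤ M * 2 ^ n) :
    Continuous (Function.uncurry (velocity r q F)) := by
  obtain ⟨u, hu, hb⟩ := exists_summable_bound hr hr2 hq hq1 hM
  refine continuous_tsum (fun n ↦ ?_) hu fun n p ↦ hb n p.1 _
  exact ((continuous_scaleDeriv r q n).comp continuous_fst).smul <| (hF n).comp <|
    (((continuous_scale r q n).comp continuous_fst).inv₀ fun p ↦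
      (scale_pos hr hr2 q n p.1).ne').smul continuous_snd

theorem exists_norm_velocity_le (hr : 0 < r) (hr2 : r < 1 / 2) (hq : 2 * r < q) (hq1 : q < 1)
    (hM : ∀ n z, ‖F n z‖ ≤ M * 2 ^ n) : ∃ C : ℝ≥0, ∀ t x, ‖velocity r q F t x‖ ≤ C := by
  obtain ⟨u, hu, hb⟩ := exists_summable_bound hr hr2 hq hq1 hM
  exact ⟨(∑' n, u n).toNNReal, fun t x ↦
    (tsum_of_norm_bounded hu.hasSum fun n ↦ hb n t _).trans (Real.le_coe_toNNReal _)⟩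

theorem hasCompactSupport_velocity (hr : 0 < r) (hr2 : r < 1 / 2) (hq : 0 < q) (hq1 : q < 1)
    (hF : ∀ n z, 2 ^ n < ‖z‖ → F n z = 0) :
    HasCompactSupport (Function.uncurry (velocity r q F)) := by
  refine HasCompactSupport.intro (isCompact_Icc.prod (isCompact_closedBall (0 : ℝ × ℝ) 1))
    (K := Icc (0 : ℝ) 1 ×ˢ Metric.closedBall (0 : ℝ × ℝ) 1) fun p hp ↦ ?_
  obtain ⟨t, x⟩ := p
  by_cases h : ∃ n, scaleDeriv r q n t ≠ 0
  swap
  · push Not at h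
    exact velocity_eq_zero h x
  obtain ⟨n, hn⟩ := h
  have hI := mem_Ioo_of_scaleDeriv_ne_zero hq hq1 hn
  have ht : t ∈ Icc (0 : ℝ) 1 :=
    ⟨by linarith [hI.1, pow_le_one₀ hq.le hq1.le (n := n)], by linarith [hI.2, pow_pos hq (n + 1)]⟩
  have hx : 1 < ‖x‖ := by
    by_contra! h
    exact hp ⟨ht, by simpa using h⟩
  have hs := scale_pos hr hr2 q n t
  rw [Function.uncurry, velocity_eq_of_scaleDeriv_ne_zero hq hq1 hn, hF, smul_zero]
  rw [norm_smul, norm_inv, Real.norm_of_nonneg hs.le, lt_inv_mul_iff₀ hs]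
  have h1 : r ^ n * 2 ^ n ≤ 1 := by
    rw [← mul_pow]
    exact pow_le_one₀ (by positivity) (by linarith)
  have h2 := mul_le_mul_of_nonneg_right (scale_le hr hr2 q n t) (by positivity : (0 : ℝ) ≤ 2 ^ n)
  linarith

theorem weakDivFreeAt_velocity (hq : 0 < q) (hq1 : q < 1) (hF : ∀ n, ContDiff ℝ 1 (F n))
    (hdiv : ∀ n z, fderiv ℝ (fun y ↦ (F n y).1) z (1, 0) +
      fderiv ℝ (fun y ↦ (F n y).2) z (0, 1) = 0) (t : ℝ) :
    WeakDivFreeAt (velocity r q F) t := by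
  intro ψ hψ hc
  by_cases h : ∃ n, scaleDeriv r q n t ≠ 0
  · obtain ⟨n, hn⟩ := h
    simp only [velocity_eq_of_scaleDeriv_ne_zero hq hq1 hn]
    exact integral_dot2_grad2_eq_zero (((hF n).comp (contDiff_const_smul _)).const_smul _)
      (divergence_const_smul_comp_smul (hF n) _ _ (hdiv n)) (hψ.of_le (by simp)) hc
  · push Not at h
    simp [velocity_eq_zero h, dot2]

theorem exists_lipschitzWith_velocity (hr : 0 < r) (hr2 : r < 1 / 2) (hq : 0 < q) (hq1 : q < 1)
    (hF : ∀ n, ContDiff ℝ 1 (F n)) (hF0 : ∀ n z, 2 ^ n < ‖z‖ → F n z = 0) {T : ℝ} (hT : T < 1) :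
    ∃ K, ∀ t ∈ Icc 0 T, LipschitzWith K (velocity r q F t) := by
  obtain ⟨L, hL0, hL⟩ := exists_abs_scaleDeriv_le hr hr2 hq hq1
  have hLip : ∀ n, ∃ K, LipschitzWith K (F n) := fun n ↦
    ContDiff.lipschitzWith_of_hasCompactSupport (HasCompactSupport.intro
      (isCompact_closedBall (0 : ℝ × ℝ) (2 ^ n)) fun x hx ↦ hF0 n x (by simpa using hx))
      (hF n) (by simp)
  choose K hK using hLip
  obtain ⟨N, hN⟩ := exists_pow_lt_of_lt_one (sub_pos.2 hT) hq1
  set B : ℕ → ℝ≥0 := fun n ↦ (L * (r / q) ^ n).toNNReal * (K n * (r ^ (n + 1))⁻¹.toNNReal)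
  refine ⟨∑ n ∈ Finset.range N, B n, fun t ht ↦ LipschitzWith.of_dist_le_mul fun x y ↦ ?_⟩
  by_cases h : ∃ n, scaleDeriv r q n t ≠ 0
  swap
  · push Not at h
    rw [velocity_eq_zero h, velocity_eq_zero h, dist_self]
    positivity
  obtain ⟨n, hn⟩ := h
  have hnN : n < N := by
    by_contra! h
    exact hn (scaleDeriv_of_le hq hq1 (by linarith [ht.2, pow_le_pow_of_le_one hq.le hq1.le h]))
  have hs := scale_pos hr hr2 q n t
  have h1 : LipschitzWith (K n * (r ^ (n + 1))⁻¹.toNNReal)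
      fun x ↦ F n ((scale r q n t)⁻¹ • x) := by
    refine (hK n).comp (LipschitzWith.of_dist_le_mul fun x y ↦ ?_)
    rw [dist_smul₀, norm_inv, Real.norm_of_nonneg hs.le, Real.coe_toNNReal _ (by positivity)]
    gcongr
    exact pow_succ_le_scale hr hr2 q n t
  have h2 : B n ≤ ∑ n ∈ Finset.range N, B n :=
    Finset.single_le_sum (fun _ _ ↦ zero_le) (Finset.mem_range.2 hnN)
  rw [velocity_eq_of_scaleDeriv_ne_zero hq hq1 hn, velocity_eq_of_scaleDeriv_ne_zero hq hq1 hn,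
    dist_smul₀, Real.norm_eq_abs]
  refine le_trans ?_ (mul_le_mul_of_nonneg_right (NNReal.coe_le_coe.2 h2) dist_nonneg)
  rw [NNReal.coe_mul, Real.coe_toNNReal _ (by positivity), mul_assoc]
  exact mul_le_mul (hL n t) (h1.dist_le_mul x y) dist_nonneg (by positivity)

end Velocity

section Paths

variable {r q M : ℝ} {F : ℕ → ℝ × ℝ → ℝ × ℝ}

/-- Center of the `n`-th generation square of side `1` determined by the digits `c`. -/
def cell (c : ℕ → Fin 4) : ℕ → ℝ × ℝ
  | 0 => (2 : ℝ) • corner (c 0)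
  | n + 1 => (2 : ℝ) • cell c n + (2 : ℝ) • corner (c (n + 1))

theorem cell_congr {c c' : ℕ → Fin 4} {n : ℕ} (h : ∀ i ≤ n, c i = c' i) : cell c n = cell c' n := by
  induction n with
  | zero => rw [cell, cell, h 0 le_rfl]
  | succ n ih => rw [cell, cell, h _ le_rfl, ih fun i hi ↦ h i (hi.trans n.le_succ)]

theorem exists_two_smul_corner (i : Fin 4) :
    ∃ e ∈ Ico (-1 : ℤ) 1, ∃ f ∈ Ico (-1 : ℤ) 1,
      (2 : ℝ) • corner i = ((e : ℝ) + 1 / 2, (f : ℝ) + 1 / 2) := by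
  fin_cases i
  · exact ⟨-1, by simp, -1, by simp, by norm_num [corner]⟩
  · exact ⟨-1, by simp, 0, by simp, by norm_num [corner]⟩
  · exact ⟨0, by simp, -1, by simp, by norm_num [corner]⟩
  · exact ⟨0, by simp, 0, by simp, by norm_num [corner]⟩

theorem exists_cell_eq (c : ℕ → Fin 4) (n : ℕ) :
    ∃ k ∈ Ico (-2 ^ n : ℤ) (2 ^ n), ∃ l ∈ Ico (-2 ^ n : ℤ) (2 ^ n),
      cell c n = ((k : ℝ) + 1 / 2, (l : ℝ) + 1 / 2) := by
  induction n with
  | zero => simpa [cell] using exists_two_smul_corner (c 0)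
  | succ n ih =>
    obtain ⟨k, hk, l, hl, hkl⟩ := ih
    obtain ⟨e, he, f, hf, hef⟩ := exists_two_smul_corner (c (n + 1))
    simp only [mem_Ico] at hk hl he hf
    refine ⟨2 * k + 1 + e, ?_, 2 * l + 1 + f, ?_, ?_⟩
    · simp only [mem_Ico, pow_succ]; omega
    · simp only [mem_Ico, pow_succ]; omega
    · rw [cell, hkl, hef]
      ext <;> simp <;> ring

theorem norm_cell_le (c : ℕ → Fin 4) (n : ℕ) : ‖cell c n‖ ≤ 2 ^ n := by
  obtain ⟨k, hk, l, hl, hkl⟩ := exists_cell_eq c n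
  have key : ∀ {k : ℤ}, k ∈ Ico (-2 ^ n : ℤ) (2 ^ n) → |(k : ℝ) + 1 / 2| ≤ 2 ^ n := by
    intro k hk
    have h1 : ((-2 ^ n : ℤ) : ℝ) ≤ k := Int.cast_le.2 hk.1
    have h2 : ((k + 1 : ℤ) : ℝ) ≤ (2 ^ n : ℤ) := Int.cast_le.2 hk.2
    push_cast at h1 h2
    rw [abs_le]
    constructor <;> linarith
  rw [hkl, Prod.norm_def]
  exact max_le (key hk) (key hl)

theorem cantorPt_sub_sum_cell (hr : 0 ≤ r) (hr1 : r < 1) (c : ℕ → Fin 4) (n : ℕ) :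
    cantorPt r c - ∑ m ∈ Finset.range n, (r ^ m * (1 / 2 - r)) • cell c m =
      (r ^ n / 2) • cell c n + r ^ (n + 1) • cantorPt r fun j ↦ c (j + (n + 1)) := by
  induction n with
  | zero =>
    rw [cantorPt_eq hr hr1 c]
    simp [cell, smul_smul]
  | succ n ih =>
    rw [Finset.sum_range_succ, ← sub_sub, ih, cantorPt_eq hr hr1 fun j ↦ c (j + (n + 1)), cell]
    simp only [zero_add, add_right_comm _ 1 (n + 1), add_assoc]
    module

/-- The trajectory of the point `cantorPt r c`. -/
def path (r q : ℝ) (c : ℕ → Fin 4) (t : ℝ) : ℝ × ℝ :=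
  cantorPt r c - ∑' n, (r ^ n * (1 / 2 - r) * ramp q n t) • cell c n

theorem path_eq_of_le (hq : 0 < q) (hq1 : q < 1) (c : ℕ → Fin 4) {N : ℕ} {t : ℝ}
    (ht : t ≤ 1 - q ^ N) :
    path r q c t = cantorPt r c -
      ∑ n ∈ Finset.range N, (r ^ n * (1 / 2 - r) * ramp q n t) • cell c n := by
  rw [path, tsum_eq_sum fun n hn ↦ ?_]
  have h := pow_le_pow_of_le_one hq.le hq1.le (by simpa using hn : N ≤ n)
  rw [ramp_eq_zero hq hq1 (by linarith), mul_zero, zero_smul]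

theorem path_zero (hq : 0 < q) (hq1 : q < 1) (c : ℕ → Fin 4) : path r q c 0 = cantorPt r c := by
  rw [path_eq_of_le (N := 0) hq hq1 c (by simp)]
  simp

theorem path_eq_of_mem_Icc (hr : 0 ≤ r) (hr1 : r < 1) (hq : 0 < q) (hq1 : q < 1) (c : ℕ → Fin 4)
    {n : ℕ} {t : ℝ} (ht : t ∈ Icc (1 - q ^ n) (1 - q ^ (n + 1))) :
    path r q c t =
      scale r q n t • cell c n + r ^ (n + 1) • cantorPt r fun j ↦ c (j + (n + 1)) := by
  have h : ∑ m ∈ Finset.range n, (r ^ m * (1 / 2 - r) * ramp q m t) • cell c m =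
      ∑ m ∈ Finset.range n, (r ^ m * (1 / 2 - r)) • cell c m := by
    refine Finset.sum_congr rfl fun m hm ↦ ?_
    have := pow_le_pow_of_le_one hq.le hq1.le (by simpa using hm : m + 1 ≤ n)
    rw [ramp_eq_one hq hq1 (by linarith [ht.1]), mul_one]
  rw [path_eq_of_le hq hq1 c ht.2, Finset.sum_range_succ, h, ← sub_sub,
    cantorPt_sub_sum_cell hr hr1, scale]
  module

theorem path_one (hr : 0 < r) (hr2 : r < 1 / 2) (hq : 0 < q) (hq1 : q < 1) (c : ℕ → Fin 4) :
    path r q c 1 = 0 := by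
  have hr1 : r < 1 := by linarith
  have h2r : Tendsto (fun n : ℕ ↦ (2 * r) ^ n) atTop (𝓝 0) :=
    tendsto_pow_atTop_nhds_zero_of_lt_one (by linarith) (by linarith)
  have h1 : Tendsto (fun n ↦ (r ^ n / 2) • cell c n +
      r ^ (n + 1) • cantorPt r fun j ↦ c (j + (n + 1))) atTop (𝓝 0) := by
    rw [← add_zero (0 : ℝ × ℝ)]
    refine Tendsto.add ?_ ?_
    · refine squeeze_zero_norm (fun n ↦ ?_) h2r
      rw [norm_smul, Real.norm_of_nonneg (by positivity)]
      calc r ^ n / 2 * ‖cell c n‖ ≤ r ^ n * 2 ^ n := by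
            gcongr
            · linarith [pow_pos hr n]
            · exact norm_cell_le c n
        _ = (2 * r) ^ n := by rw [mul_pow, mul_comm]
    · have h3 : Tendsto (fun n : ℕ ↦ r ^ (n + 1) * (1 / (4 * (1 - r)))) atTop (𝓝 0) := by
        simpa using ((tendsto_pow_atTop_nhds_zero_of_lt_one hr.le hr1).comp
          (tendsto_add_atTop_nat 1)).mul_const (1 / (4 * (1 - r)))
      refine squeeze_zero_norm (fun n ↦ ?_) h3
      rw [norm_smul, Real.norm_of_nonneg (by positivity)]
      gcongr
      exact norm_cantorPt_le hr.le hr1 _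
  have hs : Summable fun n ↦ (r ^ n * (1 / 2 - r)) • cell c n := by
    refine .of_norm_bounded (summable_geometric_of_lt_one (r := 2 * r) (by linarith) (by linarith))
      fun n ↦ ?_
    rw [norm_smul, Real.norm_of_nonneg (mul_nonneg (by positivity) (by linarith)), mul_pow]
    calc r ^ n * (1 / 2 - r) * ‖cell c n‖ ≤ r ^ n * 1 * 2 ^ n := by
          gcongr
          · linarith
          · exact norm_cell_le c n
      _ = 2 ^ n * r ^ n := by ring
  have h4 := (hs.hasSum.tendsto_sum_nat.const_sub (cantorPt r c))
  simp only [cantorPt_sub_sum_cell hr.le hr1] at h4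
  have h5 := tendsto_nhds_unique h4 h1
  rw [path, ← h5]
  congr 1
  refine tsum_congr fun n ↦ ?_
  rw [ramp_eq_one hq hq1 (by linarith [pow_pos hq (n + 1)]), mul_one]

theorem velocity_path (hr : 0 < r) (hr2 : r < 1 / 2) (hq : 0 < q) (hq1 : q < 1)
    (hF : ∀ n, ∀ k ∈ Ico (-2 ^ n : ℤ) (2 ^ n), ∀ l ∈ Ico (-2 ^ n : ℤ) (2 ^ n), ∀ z : ℝ × ℝ,
      ‖z - ((k : ℝ) + 1 / 2, (l : ℝ) + 1 / 2)‖ ≤ 1 / (4 * (1 - r)) →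
        F n z = ((k : ℝ) + 1 / 2, (l : ℝ) + 1 / 2)) (c : ℕ → Fin 4) (t : ℝ) :
    velocity r q F t (path r q c t) = ∑' n, scaleDeriv r q n t • cell c n := by
  have hr1 : r < 1 := by linarith
  refine tsum_congr fun n ↦ ?_
  by_cases hn : scaleDeriv r q n t = 0
  · rw [hn, zero_smul, zero_smul]
  have hs := scale_pos hr hr2 q n t
  obtain ⟨k, hk, l, hl, hkl⟩ := exists_cell_eq c n
  rw [hkl, hF n k hk l hl, ← hkl]
  rw [← hkl, path_eq_of_mem_Icc hr.le hr1 hq hq1 c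
    (Ioo_subset_Icc_self (mem_Ioo_of_scaleDeriv_ne_zero hq hq1 hn)), smul_add,
    inv_smul_smul₀ hs.ne', add_sub_cancel_left, smul_smul, norm_smul,
    Real.norm_of_nonneg (by positivity)]
  refine (mul_le_of_le_one_left (norm_nonneg _) ?_).trans (norm_cantorPt_le hr.le hr1 _)
  rw [inv_mul_le_one₀ hs]
  exact pow_succ_le_scale hr hr2 q n t

theorem hasDerivAt_path (hr : 0 < r) (hr2 : r < 1 / 2) (hq : 2 * r < q) (hq1 : q < 1)
    (c : ℕ → Fin 4) (t : ℝ) :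
    HasDerivAt (path r q c) (∑' n, scaleDeriv r q n t • cell c n) t := by
  have hq0 : 0 < q := by linarith
  obtain ⟨u, hu, hb⟩ := exists_summable_bound (F := fun n _ ↦ cell c n) (M := 1) hr hr2 hq hq1
    fun n _ ↦ by simpa using norm_cell_le c n
  have h1 : ∀ n t, HasDerivAt (fun t ↦ (r ^ n * (1 / 2 - r) * ramp q n t) • cell c n)
      (-(scaleDeriv r q n t • cell c n)) t := by
    intro n t
    refine (((hasDerivAt_ramp q n t).const_mul _).smul_const (cell c n)).congr_deriv ?_
    rw [scaleDeriv, neg_smul, neg_neg]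
  have h2 := (hasDerivAt_tsum (y₀ := 0) hu h1 (fun n t ↦ by simpa using hb n t 0)
    (by simp [ramp_eq_zero hq0 hq1 (sub_nonneg.2 (pow_le_one₀ hq0.le hq1.le))]) t).const_sub (cantorPt r c)
  rwa [tsum_neg, neg_neg] at h2

theorem dimH_range_path (hq : 0 < q) (hq1 : q < 1) {t : ℝ}
    (ht : t < 1) : dimH (range fun c ↦ path r q c t) = dimH (range (cantorPt r)) := by
  obtain ⟨N, hN⟩ := exists_pow_lt_of_lt_one (sub_pos.2 ht) hq1
  set R : (ℕ → Fin 4) → Fin N → Fin 4 := fun c i ↦ c i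
  have hcover : ∀ f : (ℕ → Fin 4) → ℝ × ℝ,
      dimH (range f) = ⨆ p, dimH (f '' (R ⁻¹' {p})) := by
    intro f
    rw [← dimH_iUnion, ← image_iUnion, ← preimage_iUnion, iUnion_of_singleton, preimage_univ,
      image_univ]
  rw [hcover, hcover]
  refine iSup_congr fun p ↦ ?_
  rcases (R ⁻¹' {p}).eq_empty_or_nonempty with h | ⟨c₀, hc₀⟩
  · simp [h]
  set v := ∑ n ∈ Finset.range N, (r ^ n * (1 / 2 - r) * ramp q n t) • cell c₀ n
  have h1 : (fun c ↦ path r q c t) '' (R ⁻¹' {p}) =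
      (fun x ↦ x - v) '' (cantorPt r '' (R ⁻¹' {p})) := by
    rw [image_image]
    refine image_congr fun c hc ↦ ?_
    rw [path_eq_of_le hq hq1 c (by linarith)]
    congr 1
    refine Finset.sum_congr rfl fun n hn ↦ ?_
    rw [cell_congr fun i hi ↦ ?_]
    exact congrFun (Eq.trans hc hc₀.symm : R c = R c₀) ⟨i, hi.trans_lt (Finset.mem_range.1 hn)⟩
  rw [h1]
  exact (IsometryEquiv.subRight v).isometry.dimH_image _

end Paths

/-- For every `h ∈ (1,2)` there are a bounded, uniformly continuous,
compactly supported, weakly divergence-free velocity `W` on `[0,1] × ℝ²`, a compact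
set `S` of Hausdorff dimension `h`, and a unique trajectory map `X` for `W` on `ℝ²`,
such that `X t '' S` has Hausdorff dimension `h` for every `t ∈ [0,1)` while
`X 1 '' S = {(0,0)}`. -/
theorem statement4 :
    ∀ h : ℝ, h ∈ Ioo (1 : ℝ) 2 →
    ∃ (W : ℝ → ℝ × ℝ → ℝ × ℝ) (S : Set (ℝ × ℝ)) (X : ℝ → ℝ × ℝ → ℝ × ℝ),
      (∃ C : ℝ, ∀ t ∈ Icc (0 : ℝ) 1, ∀ x, ‖W t x‖ ≤ C) ∧
      UniformContinuousOn (Function.uncurry W) (Icc (0 : ℝ) 1 ×ˢ (univ : Set (ℝ × ℝ))) ∧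
      HasCompactSupport (Function.uncurry W) ∧
      (∀ t ∈ Icc (0 : ℝ) 1, WeakDivFreeAt W t) ∧
      IsCompact S ∧
      dimH S = ENNReal.ofReal h ∧
      IsTrajOn 1 W univ X ∧
      (∀ X' : ℝ → ℝ × ℝ → ℝ × ℝ, IsTrajOn 1 W univ X' →
        ∀ t ∈ Icc (0 : ℝ) 1, ∀ a, X' t a = X t a) ∧
      (∀ t ∈ Ico (0 : ℝ) 1, dimH (X t '' S) = ENNReal.ofReal h) ∧
      X 1 '' S = {((0 : ℝ), (0 : ℝ))} := by
  intro h ⟨h1, h2⟩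
  obtain ⟨r, hr, hr2, hrh⟩ : ∃ r : ℝ, 0 < r ∧ r < 1 / 2 ∧ r ^ h = 1 / 4 := by
    refine ⟨(1 / 4) ^ h⁻¹, by positivity, ?_, ?_⟩
    · calc (1 / 4 : ℝ) ^ h⁻¹ < (1 / 4) ^ (1 / 2 : ℝ) := by
            refine Real.rpow_lt_rpow_of_exponent_gt (by norm_num) (by norm_num) ?_
            rw [one_div]
            exact inv_strictAnti₀ (by linarith) h2
        _ = 1 / 2 := by
            rw [← Real.sqrt_eq_rpow, show (1 / 4 : ℝ) = (1 / 2) ^ 2 by norm_num]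
            exact Real.sqrt_sq (by norm_num)
    · rw [← Real.rpow_mul (by norm_num), inv_mul_cancel₀ (by linarith), Real.rpow_one]
  have hr1 : r < 1 := by linarith
  obtain ⟨q, hq, hq1⟩ := exists_between (show 2 * r < 1 by linarith)
  have hq0 : 0 < q := by linarith
  obtain ⟨F, M, hF, hM, hF0, hdiv, hFc⟩ := exists_gridField (a := 1 / (4 * (1 - r)))
    (by have := sub_pos.2 hr1; positivity)
    (by rw [div_lt_div_iff₀ (by linarith) (by norm_num)]; linarith)
  have hcont := continuous_velocity hr hr2 hq hq1 (fun n ↦ (hF n).continuous) hM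
  have hsupp := hasCompactSupport_velocity hr hr2 hq0 hq1 hF0
  have hlip : ∀ T < (1 : ℝ), ∃ K, ∀ t ∈ Icc 0 T, LipschitzWith K (velocity r q F t) :=
    fun T hT ↦ exists_lipschitzWith_velocity hr hr2 hq0 hq1 hF hF0 hT
  obtain ⟨C, hC⟩ := exists_norm_velocity_le hr hr2 hq hq1 hM
  choose Y hY0 hY using exists_integralCurve_Icc_of_lipschitz_before_one hcont hC hlip
  have hpath : ∀ c, ∀ t ∈ Icc (0 : ℝ) 1, Y (cantorPt r c) t = path r q c t := fun c ↦
    eqOn_Icc_of_lipschitz_before_one hlip le_rfl (hY _)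
      (fun t _ ↦ velocity_path hr hr2 hq0 hq1 hFc c t ▸
        (hasDerivAt_path hr hr2 hq hq1 c t).hasDerivWithinAt)
      ((hY0 _).trans (path_zero hq0 hq1 c).symm)
  have hdim := dimH_range_cantorPt hr hr2 (by linarith) hrh
  refine ⟨velocity r q F, range (cantorPt r), fun t a ↦ Y a t, ⟨C, fun t _ ↦ hC t⟩,
    (hsupp.uniformContinuous_of_continuous hcont).uniformContinuousOn, hsupp,
    fun t _ ↦ weakDivFreeAt_velocity hq0 hq1 hF hdiv t,
    isCompact_range (continuous_cantorPt hr.le hr1), hdim, fun a _ ↦ ⟨hY0 a, hY a⟩,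
    fun X' hX' t ht a ↦ ?_, fun t ht ↦ ?_, ?_⟩
  · exact eqOn_Icc_of_lipschitz_before_one hlip le_rfl (hX' a trivial).2 (hY a)
      ((hX' a trivial).1.trans (hY0 a).symm) ht
  · rw [← hdim, ← dimH_range_path hq0 hq1 ht.2, ← range_comp]
    congr 2
    exact funext fun c ↦ hpath c t ⟨ht.1, ht.2.le⟩
  · rw [← range_comp]
    refine Eq.trans (congrArg range (funext fun c ↦ ?_)) range_const
    exact (hpath c 1 (by simp)).trans (path_one hr hr2 hq0 hq1 c)

end
end

section
/- Let μ₀ be a finite Borel measure on ℝ² with support A, let T > 0, and let u : [0,T]×ℝ² → ℝ² be continuous. Suppose X : [0,T]×A → ℝ² is a trajectory map for u on A such that X(t,·) is Borel measurable for each t ∈ [0,T]. Then the family of measures μ(t) := X(t,·)#μ₀ (the pushforward of μ₀ under a ↦ X(t,a)) is weakly advected by u on [0,T]. -/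
open MeasureTheory Set

noncomputable section

/-- A family of measures `μ t` is weakly advected by the velocity `u` on `[0, T]`. -/
def WeaklyAdvected (T : ℝ) (u : ℝ → ℝ × ℝ → ℝ × ℝ)
    (μ : ℝ → Measure (ℝ × ℝ)) : Prop :=
  ∀ φ : ℝ → ℝ × ℝ → ℝ,
    ContDiff ℝ (⊤ : ℕ∞) (Function.uncurry φ) → HasCompactSupport (Function.uncurry φ) →
    (∫ t in Icc (0 : ℝ) T, ∫ x, deriv (fun s => φ s x) t ∂(μ t))
      - (∫ x, φ T x ∂(μ T)) + (∫ x, φ 0 x ∂(μ 0))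
      + (∫ t in Icc (0 : ℝ) T, ∫ x, dot2 (u t x) (grad2 (φ t) x) ∂(μ t)) = 0

/-- The support of a Borel measure: points all of whose neighbourhoods have
positive measure. -/
def mSupp (μ : Measure (ℝ × ℝ)) : Set (ℝ × ℝ) := {x | ∀ U ∈ nhds x, 0 < μ U}

/-- The complement of the support of a measure on `ℝ × ℝ` is null. -/
lemma ae_mem_mSupp (μ : Measure (ℝ × ℝ)) : ∀ᵐ a ∂μ, a ∈ mSupp μ := by
  refine measure_null_of_locally_null _ fun x hx => ?_
  have hx' : ¬ ∀ U ∈ nhds x, 0 < μ U := hx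
  push Not at hx'
  obtain ⟨U, hU, h0⟩ := hx'
  exact ⟨U, mem_nhdsWithin_of_mem_nhds hU, le_antisymm h0 bot_le⟩

/-- Integrating a bounded continuous function along continuous trajectories gives
a continuous function of time. -/
lemma continuousOn_integral_comp_trajectory {μ : Measure (ℝ × ℝ)} [IsFiniteMeasure μ]
    {s : Set ℝ} {X : ℝ → ℝ × ℝ → ℝ × ℝ}
    (hXm : ∀ t ∈ s, Measurable (X t))
    (hXc : ∀ᵐ a ∂μ, ContinuousOn (fun t => X t a) s)
    {h : ℝ × (ℝ × ℝ) → ℝ} (hh : ContinuousOn h (s ×ˢ univ))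
    {C : ℝ} (hC : ∀ p ∈ s ×ˢ (univ : Set (ℝ × ℝ)), ‖h p‖ ≤ C) :
    ContinuousOn (fun t => ∫ a, h (t, X t a) ∂μ) s := by
  refine continuousOn_of_dominated (bound := fun _ => C) (fun t ht => ?_)
    (fun t ht => .of_forall fun a => hC _ ⟨ht, mem_univ _⟩) (integrable_const C) ?_
  · have hc : Continuous fun x => h (t, x) :=
      hh.comp_continuous (by fun_prop) fun x => ⟨ht, mem_univ _⟩
    exact (hc.measurable.comp (hXm t ht)).aestronglyMeasurable
  · filter_upwards [hXc] with a ha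
    exact hh.comp (continuousOn_id.prodMk ha) fun t ht => ⟨ht, mem_univ _⟩

/-- A function continuous on a closed set and vanishing outside a compact set is bounded
on the closed set. -/
lemma exists_bound_of_continuousOn_of_eq_zero {α : Type*} [TopologicalSpace α]
    {h : α → ℝ} {S K : Set α} (hS : IsClosed S) (hK : IsCompact K)
    (hh : ContinuousOn h S) (h0 : ∀ p ∉ K, h p = 0) : ∃ C, ∀ p ∈ S, ‖h p‖ ≤ C := by
  obtain ⟨C, hC⟩ := (hK.inter_right hS).exists_bound_of_continuousOn (hh.mono inter_subset_right)
  refine ⟨max C 0, fun p hp => ?_⟩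
  by_cases hpK : p ∈ K
  · exact (hC p ⟨hpK, hp⟩).trans (le_max_left _ _)
  · simp [h0 p hpK]

/-- The time derivative as a directional derivative in space-time. -/
lemma deriv_eq_fderiv_uncurry {φ : ℝ → ℝ × ℝ → ℝ} {t : ℝ} {x : ℝ × ℝ}
    (hφ : DifferentiableAt ℝ (Function.uncurry φ) (t, x)) :
    deriv (fun s => φ s x) t = fderiv ℝ (Function.uncurry φ) (t, x) (1, 0) :=
  (hφ.hasFDerivAt.comp_hasDerivAt (f := fun s => (s, x)) t ((hasDerivAt_id t).prodMk
    (hasDerivAt_const t x))).deriv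

/-- Pairing with the spatial gradient is a directional derivative in space-time. -/
lemma dot2_grad2_eq_fderiv_uncurry {φ : ℝ → ℝ × ℝ → ℝ} {t : ℝ} {x : ℝ × ℝ}
    (hφ : DifferentiableAt ℝ (Function.uncurry φ) (t, x)) (v : ℝ × ℝ) :
    dot2 v (grad2 (φ t) x) = fderiv ℝ (Function.uncurry φ) (t, x) (0, v) := by
  have hx : HasFDerivAt (φ t) ((fderiv ℝ (Function.uncurry φ) (t, x)).comp
      (ContinuousLinearMap.inr ℝ ℝ (ℝ × ℝ))) x :=
    HasFDerivAt.comp x hφ.hasFDerivAt (hasFDerivAt_prodMk_right t x)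
  have hv : ((0 : ℝ), v) = v.1 • ((0 : ℝ), ((1 : ℝ), (0 : ℝ))) + v.2 • (0, (0, 1)) := by
    ext <;> simp
  rw [hv, map_add, map_smul, map_smul, dot2, grad2, hx.fderiv]
  simp

/-- If `μ₀` is a finite Borel measure with support `A`, `u` is
continuous on `[0,T] × ℝ²`, and `X` is a trajectory map for `u` on `A` with `X t`
Borel measurable, then `μ t := (X t) # μ₀` is weakly advected by `u` on `[0,T]`. -/
theorem statement5 (μ₀ : Measure (ℝ × ℝ)) [IsFiniteMeasure μ₀]
    (A : Set (ℝ × ℝ)) (hA : mSupp μ₀ = A)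
    (T : ℝ) (hT : 0 < T)
    (u : ℝ → ℝ × ℝ → ℝ × ℝ)
    (hu : ContinuousOn (Function.uncurry u) (Icc (0 : ℝ) T ×ˢ (univ : Set (ℝ × ℝ))))
    (X : ℝ → ℝ × ℝ → ℝ × ℝ)
    (hX : IsTrajOn T u A X)
    (hXm : ∀ t ∈ Icc (0 : ℝ) T, Measurable (X t)) :
    WeaklyAdvected T u (fun t => Measure.map (X t) μ₀) := by
  intro φ hφ hφc
  subst hA
  set Φ := Function.uncurry φ with hΦ
  set S : Set (ℝ × (ℝ × ℝ)) := Icc (0 : ℝ) T ×ˢ univ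
  have hSc : IsClosed S := isClosed_Icc.prod isClosed_univ
  have hd : Differentiable ℝ Φ := hφ.differentiable (by simp)
  have hD : Continuous (fderiv ℝ Φ) := hφ.continuous_fderiv (by simp)
  have hD0 : ∀ p ∉ tsupport Φ, fderiv ℝ Φ p = 0 := fun p hp =>
    image_eq_zero_of_notMem_tsupport fun h => hp (tsupport_fderiv_subset ℝ h)
  have hgt : ContinuousOn (fun p => fderiv ℝ Φ p (1, 0)) S :=
    (hD.clm_apply continuous_const).continuousOn
  have hgx : ContinuousOn (fun p => fderiv ℝ Φ p (0, Function.uncurry u p)) S :=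
    hD.continuousOn.clm_apply (continuousOn_const.prodMk hu)
  obtain ⟨C, hC⟩ := exists_bound_of_continuousOn_of_eq_zero hSc hφc hφ.continuous.continuousOn
    fun p hp => image_eq_zero_of_notMem_tsupport hp
  obtain ⟨Ct, hCt⟩ := exists_bound_of_continuousOn_of_eq_zero hSc hφc hgt
    fun p hp => by simp [hD0 p hp]
  obtain ⟨Cx, hCx⟩ := exists_bound_of_continuousOn_of_eq_zero hSc hφc hgx
    fun p hp => by simp [hD0 p hp]
  have htraj : ∀ᵐ a ∂μ₀, ∀ t ∈ Icc (0 : ℝ) T,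
      HasDerivWithinAt (fun s => X s a) (u t (X t a)) (Icc (0 : ℝ) T) t := by
    filter_upwards [ae_mem_mSupp μ₀] with a ha using (hX a ha).2
  have hXc : ∀ᵐ a ∂μ₀, ContinuousOn (fun t => X t a) (Icc 0 T) := by
    filter_upwards [htraj] with a ha t ht using (ha t ht).continuousWithinAt
  have hmeas : ∀ h : ℝ × (ℝ × ℝ) → ℝ, ContinuousOn h S → ∀ t ∈ Icc (0 : ℝ) T,
      Measurable fun x => h (t, x) := fun h hh t ht =>
    (hh.comp_continuous (f := fun x => (t, x)) (by fun_prop)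
      fun x => ⟨ht, mem_univ _⟩).measurable
  have hmap : ∀ h : ℝ × (ℝ × ℝ) → ℝ, ContinuousOn h S → ∀ t ∈ Icc (0 : ℝ) T,
      ∫ x, h (t, x) ∂(μ₀.map (X t)) = ∫ a, h (t, X t a) ∂μ₀ := fun h hh t ht =>
    integral_map (hXm t ht).aemeasurable (hmeas h hh t ht).aestronglyMeasurable
  have hint : ∀ (h : ℝ × (ℝ × ℝ) → ℝ) (C : ℝ), ContinuousOn h S → (∀ p ∈ S, ‖h p‖ ≤ C) →
      ∀ t ∈ Icc (0 : ℝ) T, Integrable (fun a => h (t, X t a)) μ₀ := fun h C hh hC t ht =>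
    .of_bound ((hmeas h hh t ht).comp (hXm t ht)).aestronglyMeasurable C
      (.of_forall fun a => hC _ ⟨ht, mem_univ _⟩)
  have hGt := continuousOn_integral_comp_trajectory hXm hXc hgt hCt
  have hGx := continuousOn_integral_comp_trajectory hXm hXc hgx hCx
  have hF := continuousOn_integral_comp_trajectory hXm hXc
    hφ.continuous.continuousOn hC
  have hderiv : ∀ t ∈ Ioo (0 : ℝ) T, HasDerivAt (fun t => ∫ a, Φ (t, X t a) ∂μ₀)
      ((∫ a, fderiv ℝ Φ (t, X t a) (1, 0) ∂μ₀)
        + ∫ a, fderiv ℝ Φ (t, X t a) (0, Function.uncurry u (t, X t a)) ∂μ₀) t := by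
    intro t ht
    have ht' := Ioo_subset_Icc_self ht
    rw [← integral_add (hint _ _ hgt hCt t ht') (hint _ _ hgx hCx t ht')]
    refine (hasDerivAt_integral_of_dominated_loc_of_deriv_le (bound := fun _ => Ct + Cx)
      (F := fun t a => Φ (t, X t a))
      (F' := fun t a => fderiv ℝ Φ (t, X t a) (1, 0) + fderiv ℝ Φ (t, X t a) (0, Function.uncurry u (t, X t a)))
      (Ioo_mem_nhds ht.1 ht.2) ?_ (hint _ _ hφ.continuous.continuousOn hC t ht')
      ((hint _ _ hgt hCt t ht').add (hint _ _ hgx hCx t ht')).aestronglyMeasurable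
      ?_ (integrable_const _) ?_).2
    · filter_upwards [Icc_mem_nhds ht.1 ht.2] with s hs
      exact (hint _ _ hφ.continuous.continuousOn hC s hs).aestronglyMeasurable
    · refine .of_forall fun a s hs => (norm_add_le _ _).trans ?_
      have hs' : (s, X s a) ∈ S := ⟨Ioo_subset_Icc_self hs, mem_univ _⟩
      exact add_le_add (hCt _ hs') (hCx _ hs')
    · filter_upwards [htraj] with a ha s hs
      have hXd := (ha s (Ioo_subset_Icc_self hs)).hasDerivAt (Icc_mem_nhds hs.1 hs.2)
      rw [← map_add]
      simpa [Function.comp_def] using (hd (s, X s a)).hasFDerivAt.comp_hasDerivAt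
        (f := fun t => (t, X t a)) s ((hasDerivAt_id s).prodMk hXd)
  have hIt := hGt.intervalIntegrable_of_Icc (μ := volume) hT.le
  have hIx := hGx.intervalIntegrable_of_Icc (μ := volume) hT.le
  have hftc := intervalIntegral.integral_eq_sub_of_hasDerivAt_of_le hT.le hF hderiv (hIt.add hIx)
  rw [intervalIntegral.integral_add hIt hIx, intervalIntegral.integral_of_le hT.le,
    intervalIntegral.integral_of_le hT.le, ← integral_Icc_eq_integral_Ioc,
    ← integral_Icc_eq_integral_Ioc] at hftc
  have h_time : (∫ t in Icc (0 : ℝ) T, ∫ x, deriv (fun s => φ s x) t ∂(μ₀.map (X t)))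
      = ∫ t in Icc (0 : ℝ) T, ∫ a, fderiv ℝ Φ (t, X t a) (1, 0) ∂μ₀ := by
    refine setIntegral_congr_fun measurableSet_Icc fun t ht => ?_
    simp only [deriv_eq_fderiv_uncurry (hd _)]
    exact hmap _ hgt t ht
  have h_space : (∫ t in Icc (0 : ℝ) T, ∫ x, dot2 (u t x) (grad2 (φ t) x) ∂(μ₀.map (X t)))
      = ∫ t in Icc (0 : ℝ) T, ∫ a, fderiv ℝ Φ (t, X t a) (0, Function.uncurry u (t, X t a)) ∂μ₀ := by
    refine setIntegral_congr_fun measurableSet_Icc fun t ht => ?_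
    simp only [dot2_grad2_eq_fderiv_uncurry (hd _)]
    exact hmap _ hgx t ht
  have h_final := hmap Φ hφ.continuous.continuousOn T (right_mem_Icc.2 hT.le)
  have h_initial := hmap Φ hφ.continuous.continuousOn 0 (left_mem_Icc.2 hT.le)
  simp only [hΦ, Function.uncurry_apply_pair] at h_final h_initial h_time h_space hftc ⊢
  rw [h_time, h_space, h_final, h_initial]
  linarith

end
end

section
/- Let α ∈ (1/2, 1/√2). The set S_α is invariant under the reflection σ₁ in the x-axis, σ₁(x₁,x₂) = (x₁,−x₂), and under the reflection σ₂ in the y-axis, σ₂(x₁,x₂) = (−x₁,x₂); that is, σ₁(S_α) = S_α and σ₂(S_α) = S_α. -/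
open Set

noncomputable section

/-- Rotation by `π/2` about the origin. -/
def Rot (x : ℝ × ℝ) : ℝ × ℝ := (-x.2, x.1)

/-- The affine map `F₁ x = (1,0) + α R x`. -/
def F1 (α : ℝ) (x : ℝ × ℝ) : ℝ × ℝ := ((1 : ℝ), 0) + α • Rot x

/-- The affine map `F₂ x = (-1,0) + α R x`. -/
def F2 (α : ℝ) (x : ℝ × ℝ) : ℝ × ℝ := ((-1 : ℝ), 0) + α • Rot x

/-- `F₁` or `F₂`, indexed by a letter of the alphabet `{1, 2}` (as a `Bool`,
`true ↦ F₁`, `false ↦ F₂`). -/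
def Fb (α : ℝ) (b : Bool) : ℝ × ℝ → ℝ × ℝ := if b then F1 α else F2 α

/-- For a finite word `w = (w₁, …, w_k)` (a `List Bool`), the composition
`F_w = F_{w₁} ∘ … ∘ F_{w_k}`; the empty word gives the identity. -/
def Fw (α : ℝ) (w : List Bool) : ℝ × ℝ → ℝ × ℝ :=
  w.foldr (fun b f => Fb α b ∘ f) id

/-- The segment `I = [-1,1] × {0}`. -/
def ISeg : Set (ℝ × ℝ) := Icc (-1 : ℝ) 1 ×ˢ ({0} : Set ℝ)

/-- The inhomogeneous self-similar set `S_α`: the closure of the union of the images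
of `I` under all the maps `F_w`, `w` a finite word in `{1,2}`. -/
def Sset (α : ℝ) : Set (ℝ × ℝ) := closure (⋃ w : List Bool, Fw α w '' ISeg)

/-- The reflection in the `x`-axis. -/
def reflectX (p : ℝ × ℝ) : ℝ × ℝ := (p.1, -p.2)

/-- The reflection in the `y`-axis. -/
def reflectY (p : ℝ × ℝ) : ℝ × ℝ := (-p.1, p.2)

lemma reflectX_Fb (α : ℝ) (b : Bool) (p : ℝ × ℝ) :
    reflectX (Fb α b p) = Fb α b (reflectY p) := by
  cases b <;> simp [reflectX, reflectY, Fb, F1, F2, Rot]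

lemma reflectY_Fb (α : ℝ) (b : Bool) (p : ℝ × ℝ) :
    reflectY (Fb α b p) = Fb α (!b) (reflectX p) := by
  cases b <;> simp [reflectX, reflectY, Fb, F1, F2, Rot] <;> ring

lemma Fb_mem_iUnion {α : ℝ} {p : ℝ × ℝ} (b : Bool) (hp : p ∈ ⋃ w, Fw α w '' ISeg) :
    Fb α b p ∈ ⋃ w, Fw α w '' ISeg := by
  obtain ⟨w, x, hx, rfl⟩ := mem_iUnion.1 hp
  exact mem_iUnion.2 ⟨b :: w, x, hx, rfl⟩

lemma reflect_Fw_mem_iUnion (α : ℝ) {x : ℝ × ℝ} (hx : x ∈ ISeg) (w : List Bool) :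
    reflectX (Fw α w x) ∈ ⋃ w, Fw α w '' ISeg ∧
      reflectY (Fw α w x) ∈ ⋃ w, Fw α w '' ISeg := by
  induction w with
  | nil =>
    obtain ⟨⟨h₁, h₂⟩, h₃⟩ := hx
    have h₃ : x.2 = 0 := h₃
    exact ⟨mem_iUnion.2 ⟨[], reflectX x, ⟨⟨h₁, h₂⟩, by simp [reflectX, h₃]⟩, rfl⟩,
      mem_iUnion.2 ⟨[], reflectY x, ⟨⟨neg_le_neg h₂, neg_le.1 h₁⟩, h₃⟩, rfl⟩⟩
  | cons b w ih =>
    change reflectX (Fb α b (Fw α w x)) ∈ _ ∧ reflectY (Fb α b (Fw α w x)) ∈ _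
    rw [reflectX_Fb, reflectY_Fb]
    exact ⟨Fb_mem_iUnion b ih.2, Fb_mem_iUnion (!b) ih.1⟩

lemma image_closure_eq_of_involutive {X : Type*} [TopologicalSpace X] {f : X → X} {s : Set X}
    (hf : Function.Involutive f) (hc : Continuous f) (hs : MapsTo f s s) :
    f '' closure s = closure s :=
  (hs.closure hc).image_subset.antisymm fun x hx => ⟨f x, hs.closure hc hx, hf x⟩

/-- For `α ∈ (1/2, 1/√2)`, the set `S_α` is invariant under the
reflection `σ₁` in the `x`-axis and the reflection `σ₂` in the `y`-axis. -/
theorem statement8 (α : ℝ) (hα : α ∈ Ioo (1/2 : ℝ) (Real.sqrt 2)⁻¹) :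
    (fun p : ℝ × ℝ => (p.1, -p.2)) '' Sset α = Sset α ∧
    (fun p : ℝ × ℝ => (-p.1, p.2)) '' Sset α = Sset α := by
  have key : ∀ p ∈ ⋃ w, Fw α w '' ISeg, reflectX p ∈ ⋃ w, Fw α w '' ISeg ∧
      reflectY p ∈ ⋃ w, Fw α w '' ISeg := by
    intro p hp
    obtain ⟨w, x, hx, rfl⟩ := mem_iUnion.1 hp
    exact reflect_Fw_mem_iUnion α hx w
  exact ⟨image_closure_eq_of_involutive (fun p => by simp) (by fun_prop) fun p hp => (key p hp).1,
    image_closure_eq_of_involutive (fun p => by simp) (by fun_prop) fun p hp => (key p hp).2⟩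

end
end

section
/- Let α ∈ (1/2, 1/√2). Then the Hausdorff dimension of S_α equals −log 2 / log α = log 2 / log(1/α), which lies in (1,2). In particular, for h ∈ (1,2) and α = 2^{−1/h}, the Hausdorff dimension of S_α equals h. -/
open Set

noncomputable section

open Filter Topology
open scoped NNReal ENNReal

section Coding

/-- The sequence whose first letter is `b` and whose tail is `x`. -/
def consSeq (b : Bool) (x : ℕ → Bool) : ℕ → Bool
  | 0 => b
  | n + 1 => x n

/-- If two codings `π`, `ρ` of sequences are such that `π` separates sequences first differing at
`n` by at least `c * a ^ n`, and `ρ` brings sequences agreeing up to `n` within `C * (a ^ r) ^ n`,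
then `ρ ∘ π⁻¹` is Hölder of exponent `r`, which compares the dimensions of the ranges. -/
theorem dimH_range_le_of_coding {X Y : Type*} [MetricSpace X] [MetricSpace Y]
    {π : (ℕ → Bool) → X} {ρ : (ℕ → Bool) → Y} {a b c C : ℝ} {r : ℝ≥0}
    (ha : 0 < a) (hc : 0 < c) (hC : 0 ≤ C) (hr : 0 < r) (hab : a ^ (r : ℝ) = b)
    (hπ : ∀ n x y, (∀ i < n, x i = y i) → x n ≠ y n → c * a ^ n ≤ dist (π x) (π y))
    (hρ : ∀ n x y, (∀ i < n, x i = y i) → dist (ρ x) (ρ y) ≤ C * b ^ n) :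
    dimH (range ρ) ≤ dimH (range π) / r := by
  have hr' : (0 : ℝ) < r := by exact_mod_cast hr
  set D : ℝ := C / c ^ (r : ℝ) with hD
  have hD0 : 0 ≤ D := by positivity
  have key : ∀ x y, dist (ρ x) (ρ y) ≤ D * dist (π x) (π y) ^ (r : ℝ) := by
    intro x y
    rcases eq_or_ne x y with rfl | hxy
    · simp [hr'.ne']
    have h0 : ∀ i < PiNat.firstDiff x y, x i = y i := fun i hi =>
      PiNat.apply_eq_of_lt_firstDiff hi
    set n := PiNat.firstDiff x y with hn
    calc dist (ρ x) (ρ y) ≤ C * b ^ n := hρ n x y h0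
      _ = D * (c * a ^ n) ^ (r : ℝ) := by
        rw [Real.mul_rpow hc.le (by positivity), ← hab, hD, ← Real.rpow_natCast,
          ← Real.rpow_natCast, ← Real.rpow_mul ha.le, ← Real.rpow_mul ha.le, mul_comm (r : ℝ)]
        have : c ^ (r : ℝ) ≠ 0 := (Real.rpow_pos_of_pos hc _).ne'
        field_simp
      _ ≤ D * dist (π x) (π y) ^ (r : ℝ) := by
        gcongr
        exact hπ n x y h0 (PiNat.apply_firstDiff_ne hxy)
  let f : X → Y := fun p => ρ (Function.invFun π p)
  have hf : HolderOnWith ⟨D, hD0⟩ r f (range π) := by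
    rintro _ ⟨x, rfl⟩ _ ⟨y, rfl⟩
    have h := key (Function.invFun π (π x)) (Function.invFun π (π y))
    rw [Function.invFun_eq (f := π) ⟨x, rfl⟩, Function.invFun_eq (f := π) ⟨y, rfl⟩] at h
    rw [edist_dist, edist_dist, ENNReal.ofReal_rpow_of_nonneg dist_nonneg hr'.le]
    refine (ENNReal.ofReal_le_ofReal h).trans ?_
    rw [ENNReal.ofReal_mul hD0, ENNReal.ofReal_eq_coe_nnreal hD0]
    exact le_rfl
  refine (dimH_mono ?_).trans (hf.dimH_image_le hr)
  rintro _ ⟨x, rfl⟩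
  refine ⟨π x, ⟨x, rfl⟩, ?_⟩
  have h := key (Function.invFun π (π x)) x
  rw [Function.invFun_eq (f := π) ⟨x, rfl⟩, dist_self, Real.zero_rpow hr'.ne', mul_zero] at h
  exact dist_le_zero.1 h

theorem dist_coding {X : Type*} [MetricSpace X] {Φ : (ℕ → Bool) → X} {g : Bool → X → X} {a : ℝ}
    (hg : ∀ b p q, dist (g b p) (g b q) = a * dist p q)
    (hΦ : ∀ b x, Φ (consSeq b x) = g b (Φ x)) (n : ℕ) :
    ∀ x y : ℕ → Bool, (∀ i < n, x i = y i) →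
      dist (Φ x) (Φ y) = a ^ n * dist (Φ fun i => x (i + n)) (Φ fun i => y (i + n)) := by
  induction n with
  | zero => intro x y _; simp
  | succ n ih =>
    intro x y h
    have hx : ∀ x : ℕ → Bool, Φ x = g (x 0) (Φ fun i => x (i + 1)) := by
      intro x
      rw [← hΦ]
      congr 1
      funext i
      cases i <;> rfl
    have e := ih (fun i => x (i + 1)) (fun i => y (i + 1)) fun i hi => h (i + 1) (by omega)
    rw [hx x, hx y, h 0 (by omega), hg, e, pow_succ', mul_assoc]
    simp only [add_assoc]

end Coding

section SignSeries

/-- The sign of a letter: `1` for `true` and `-1` for `false`. -/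
def sgn (b : Bool) : ℝ := if b then 1 else -1

theorem abs_sgn (b : Bool) : |sgn b| = 1 := by cases b <;> simp [sgn]

/-- The series `∑ ± β ^ n` with signs given by the sequence `x`. -/
def signSeries (β : ℝ) (x : ℕ → Bool) : ℝ := ∑' n, sgn (x n) * β ^ n

variable {β : ℝ}

theorem abs_sgn_mul_pow_le (β : ℝ) (b : Bool) (n : ℕ) : ‖sgn b * β ^ n‖ ≤ |β| ^ n := by
  rw [Real.norm_eq_abs, abs_mul, abs_sgn, one_mul, abs_pow]

theorem summable_signSeries (hβ : |β| < 1) (x : ℕ → Bool) :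
    Summable fun n => sgn (x n) * β ^ n :=
  .of_norm_bounded (summable_geometric_of_lt_one (abs_nonneg _) hβ)
    fun n => abs_sgn_mul_pow_le β (x n) n

theorem abs_signSeries_le (hβ : |β| < 1) (x : ℕ → Bool) : |signSeries β x| ≤ (1 - |β|)⁻¹ :=
  tsum_of_norm_bounded (hasSum_geometric_of_lt_one (abs_nonneg _) hβ)
    fun n => abs_sgn_mul_pow_le β (x n) n

theorem continuous_signSeries (hβ : |β| < 1) : Continuous (signSeries β) := by
  refine continuous_tsum (fun n => ?_) (summable_geometric_of_lt_one (abs_nonneg _) hβ)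
    fun n x => abs_sgn_mul_pow_le β (x n) n
  have : Continuous sgn := continuous_of_discreteTopology
  fun_prop

theorem signSeries_eq (hβ : |β| < 1) (x : ℕ → Bool) :
    signSeries β x = sgn (x 0) + β * signSeries β fun n => x (n + 1) := by
  rw [signSeries, (summable_signSeries hβ x).tsum_eq_zero_add, signSeries, ← tsum_mul_left]
  simp only [pow_zero, mul_one, pow_succ]
  congr 2
  funext n
  ring

theorem le_dist_signSeries (hβ : |β| < 1) {x y : ℕ → Bool} (h : x 0 ≠ y 0) :
    2 * (1 - 2 * |β|) / (1 - |β|) ≤ |signSeries β x - signSeries β y| := by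
  have hpos : 0 < 1 - |β| := by linarith
  rw [signSeries_eq hβ x, signSeries_eq hβ y]
  set u := signSeries β fun n => x (n + 1)
  set v := signSeries β fun n => y (n + 1)
  have hu : |β * u| ≤ |β| * (1 - |β|)⁻¹ := by
    rw [abs_mul]; gcongr; exact abs_signSeries_le hβ _
  have hv : |β * v| ≤ |β| * (1 - |β|)⁻¹ := by
    rw [abs_mul]; gcongr; exact abs_signSeries_le hβ _
  have e : 2 * (1 - 2 * |β|) / (1 - |β|) = 2 - 2 * (|β| * (1 - |β|)⁻¹) := by
    field_simp; ring
  have hs : |sgn (x 0) - sgn (y 0)| = 2 := by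
    cases hx : x 0 <;> cases hy : y 0 <;> simp_all [sgn] <;> norm_num
  have t1 := abs_sub_abs_le_abs_sub (sgn (x 0) - sgn (y 0)) (β * v - β * u)
  have t2 := abs_sub (β * v) (β * u)
  rw [show sgn (x 0) + β * u - (sgn (y 0) + β * v)
    = sgn (x 0) - sgn (y 0) - (β * v - β * u) by ring, e]
  linarith

end SignSeries

section Attractor

variable {α : ℝ}

/-- The coding of the attractor of `F₁, F₂` (a product of two Cantor sets of ratio `α ^ 2`). -/
def attractorCode (α : ℝ) (x : ℕ → Bool) : ℝ × ℝ :=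
  (signSeries (-α ^ 2) fun n => x (2 * n), α * signSeries (-α ^ 2) fun n => x (2 * n + 1))

theorem dist_Fb (h0 : 0 ≤ α) (b : Bool) (p q : ℝ × ℝ) :
    dist (Fb α b p) (Fb α b q) = α * dist p q := by
  have hR : dist (Rot p) (Rot q) = dist p q := by
    simp [Rot, Prod.dist_eq, dist_neg_neg, max_comm]
  cases b <;> simp [Fb, F1, F2, dist_smul₀, hR, abs_of_nonneg h0]

theorem Fw_cons (b : Bool) (w : List Bool) (p : ℝ × ℝ) :
    Fw α (b :: w) p = Fb α b (Fw α w p) := rfl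

theorem dist_Fw (h0 : 0 ≤ α) (w : List Bool) (p q : ℝ × ℝ) :
    dist (Fw α w p) (Fw α w q) = α ^ w.length * dist p q := by
  induction w with
  | nil => simp [Fw]
  | cons b w ih => rw [Fw_cons, Fw_cons, dist_Fb h0, ih, List.length_cons, pow_succ', mul_assoc]

theorem lipschitzWith_Fw (h0 : 0 ≤ α) (w : List Bool) :
    LipschitzWith (α.toNNReal ^ w.length) (Fw α w) :=
  .of_dist_le_mul fun p q => by rw [dist_Fw h0]; simp [h0]

theorem abs_neg_sq_lt_one (h0 : 0 ≤ α) (h1 : α < 1) : |-α ^ 2| < 1 := by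
  rw [abs_neg, abs_of_nonneg (by positivity)]
  nlinarith

theorem attractorCode_consSeq (h0 : 0 ≤ α) (h1 : α < 1) (b : Bool) (x : ℕ → Bool) :
    attractorCode α (consSeq b x) = Fb α b (attractorCode α x) := by
  have e : (signSeries (-α ^ 2) fun n => consSeq b x (2 * n)) =
      sgn b + -α ^ 2 * signSeries (-α ^ 2) fun n => x (2 * n + 1) :=
    signSeries_eq (abs_neg_sq_lt_one h0 h1) _
  have h : Fb α b (attractorCode α x) = (sgn b - α * (attractorCode α x).2,
      α * (attractorCode α x).1) := by
    cases b <;> ext <;> simp [Fb, F1, F2, Rot, sgn] <;> ring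
  rw [h]
  ext
  · simp only [attractorCode, e]
    ring
  · simp [attractorCode, consSeq]

theorem continuous_attractorCode (h0 : 0 ≤ α) (h1 : α < 1) : Continuous (attractorCode α) := by
  have := continuous_signSeries (abs_neg_sq_lt_one h0 h1)
  unfold attractorCode
  fun_prop

theorem isCompact_range_attractorCode (h0 : 0 ≤ α) (h1 : α < 1) :
    IsCompact (range (attractorCode α)) :=
  isCompact_range (continuous_attractorCode h0 h1)

theorem dist_attractorCode_le (h0 : 0 ≤ α) (h1 : α < 1) {n : ℕ} {x y : ℕ → Bool}
    (h : ∀ i < n, x i = y i) :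
    dist (attractorCode α x) (attractorCode α y)
      ≤ Metric.diam (range (attractorCode α)) * α ^ n := by
  rw [dist_coding (dist_Fb h0) (attractorCode_consSeq h0 h1) n x y h, mul_comm]
  gcongr
  exact Metric.dist_le_diam_of_mem (isCompact_range_attractorCode h0 h1).isBounded
    (mem_range_self _) (mem_range_self _)

theorem le_dist_attractorCode (h0 : 0 ≤ α) (h1 : α < 1) {n : ℕ} {x y : ℕ → Bool}
    (h : ∀ i < n, x i = y i) (hn : x n ≠ y n) :
    2 * (1 - 2 * α ^ 2) / (1 - α ^ 2) * α ^ n ≤ dist (attractorCode α x) (attractorCode α y) := by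
  rw [dist_coding (dist_Fb h0) (attractorCode_consSeq h0 h1) n x y h, mul_comm]
  gcongr
  rw [Prod.dist_eq]
  refine le_trans ?_ (le_max_left _ _)
  have := le_dist_signSeries (abs_neg_sq_lt_one h0 h1) (x := fun i => x (2 * i + n))
    (y := fun i => y (2 * i + n)) (by simpa using hn)
  rwa [abs_neg, abs_of_nonneg (by positivity : 0 ≤ α ^ 2)] at this

theorem exists_Fw_attractorCode (h0 : 0 ≤ α) (h1 : α < 1) (n : ℕ) :
    ∀ x, ∃ w : List Bool, ∃ y, w.length = n ∧ attractorCode α x = Fw α w (attractorCode α y) := by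
  induction n with
  | zero => exact fun x => ⟨[], x, rfl, rfl⟩
  | succ n ih =>
    intro x
    obtain ⟨w, y, hw, h⟩ := ih fun i => x (i + 1)
    refine ⟨x 0 :: w, y, by simp [hw], ?_⟩
    rw [Fw_cons, ← h, ← attractorCode_consSeq h0 h1]
    congr 1
    funext i
    cases i <;> rfl

theorem Fw_attractorCode_mem (h0 : 0 ≤ α) (h1 : α < 1) (w : List Bool) (x : ℕ → Bool) :
    Fw α w (attractorCode α x) ∈ range (attractorCode α) := by
  induction w with
  | nil => exact ⟨x, rfl⟩
  | cons b w ih =>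
    obtain ⟨y, hy⟩ := ih
    exact ⟨consSeq b y, by rw [Fw_cons, ← hy, attractorCode_consSeq h0 h1]⟩

theorem range_attractorCode_subset_Sset (h0 : 0 ≤ α) (h1 : α < 1) :
    range (attractorCode α) ⊆ Sset α := by
  rintro _ ⟨x, rfl⟩
  obtain ⟨M, hM⟩ := (isCompact_range_attractorCode h0 h1).isBounded.subset_closedBall 0
  have hlim : Tendsto (fun n => α ^ n * M) atTop (𝓝 0) := by
    simpa using (tendsto_pow_atTop_nhds_zero_of_lt_one h0 h1).mul_const M
  refine Metric.mem_closure_iff.2 fun ε hε => ?_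
  obtain ⟨n, hn⟩ := (hlim.eventually_lt_const hε).exists
  obtain ⟨w, y, hw, h⟩ := exists_Fw_attractorCode h0 h1 n x
  refine ⟨Fw α w 0, mem_iUnion.2 ⟨w, 0, by simp [ISeg], rfl⟩, lt_of_le_of_lt ?_ hn⟩
  rw [h, dist_Fw h0, hw]
  gcongr
  exact hM (mem_range_self y)

theorem isCompact_ISeg : IsCompact ISeg := isCompact_Icc.prod isCompact_singleton

theorem Sset_subset (h0 : 0 ≤ α) (h1 : α < 1) :
    Sset α ⊆ range (attractorCode α) ∪ ⋃ w : List Bool, Fw α w '' ISeg := by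
  intro p hp
  by_contra hcon
  rw [mem_union, not_or] at hcon
  obtain ⟨hK, hU⟩ := hcon
  have hKc := (isCompact_range_attractorCode h0 h1).isClosed
  obtain ⟨M, hM⟩ := isCompact_ISeg.isBounded.subset_closedBall (attractorCode α fun _ => true)
  have hlim : Tendsto (fun n => α ^ n * M) atTop (𝓝 0) := by
    simpa using (tendsto_pow_atTop_nhds_zero_of_lt_one h0 h1).mul_const M
  refine hK (hKc.closure_subset (Metric.mem_closure_iff.2 fun ε hε => ?_))
  obtain ⟨n, hn⟩ := (hlim.eventually_lt_const (half_pos hε)).exists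
  have hclosed : IsClosed (⋃ w ∈ {w : List Bool | w.length < n}, Fw α w '' ISeg) :=
    (List.finite_length_lt Bool n).isClosed_biUnion fun w _ =>
      (isCompact_ISeg.image (lipschitzWith_Fw h0 w).continuous).isClosed
  have hp' : p ∈ closure ((⋃ w ∈ {w : List Bool | w.length < n}, Fw α w '' ISeg) ∪
      ⋃ w ∈ {w : List Bool | n ≤ w.length}, Fw α w '' ISeg) := by
    refine closure_mono (iUnion_subset fun w => ?_) hp
    rcases lt_or_ge w.length n with h | h
    · exact (subset_biUnion_of_mem (u := fun w => Fw α w '' ISeg) h).trans subset_union_left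
    · exact (subset_biUnion_of_mem (u := fun w => Fw α w '' ISeg) h).trans subset_union_right
  rw [closure_union, hclosed.closure_eq] at hp'
  rcases hp' with hp' | hp'
  · exact absurd (iUnion₂_subset (fun w _ => subset_iUnion (fun w => Fw α w '' ISeg) w) hp') hU
  obtain ⟨q, hq, hpq⟩ := Metric.mem_closure_iff.1 hp' _ (half_pos hε)
  simp only [mem_iUnion, mem_ofPred_eq] at hq
  obtain ⟨w, hw, i, hi, rfl⟩ := hq
  refine ⟨_, Fw_attractorCode_mem h0 h1 w fun _ => true, ?_⟩
  have h2 : dist (Fw α w i) (Fw α w (attractorCode α fun _ => true)) ≤ α ^ n * M := by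
    rw [dist_Fw h0]
    exact mul_le_mul (pow_le_pow_of_le_one h0 h1.le hw) (hM hi) dist_nonneg (by positivity)
  linarith [dist_triangle p (Fw α w i) (Fw α w (attractorCode α fun _ => true))]

theorem dimH_ISeg_le : dimH ISeg ≤ 1 := by
  have hL : LipschitzWith 1 fun t : ℝ => (t, (0 : ℝ)) := LipschitzWith.prodMk_right 0
  refine (dimH_mono ?_).trans (hL.dimH_range_le.trans Real.dimH_univ.le)
  rintro ⟨a, b⟩ ⟨_, hb⟩
  exact ⟨a, by simpa using (Eq.symm hb)⟩

theorem dimH_Sset_le (h0 : 0 ≤ α) (h1 : α < 1) :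
    dimH (Sset α) ≤ max (dimH (range (attractorCode α))) 1 := by
  refine (dimH_mono (Sset_subset h0 h1)).trans ?_
  rw [dimH_union, dimH_iUnion]
  gcongr
  exact iSup_le fun w => ((lipschitzWith_Fw h0 w).dimH_image_le _).trans dimH_ISeg_le

theorem le_dimH_range_attractorCode (h0 : 0 < α) (h : 2 * α ^ 2 < 1) :
    ENNReal.ofReal (-(Real.log 2) / Real.log α) ≤ dimH (range (attractorCode α)) := by
  have h1 : α < 1 := by nlinarith
  have hlog : Real.log α < 0 := Real.log_neg h0 h1
  have hlog2 : 0 < Real.log 2 := Real.log_pos one_lt_two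
  have hd : 0 < -(Real.log 2) / Real.log α := div_pos_of_neg_of_neg (by linarith) hlog
  set r : ℝ≥0 := (-(Real.log 2) / Real.log α).toNNReal with hr
  have hr0 : 0 < r := Real.toNNReal_pos.2 hd
  have hab : α ^ (r : ℝ) = (2 : ℝ)⁻¹ := by
    rw [hr, Real.coe_toNNReal _ hd.le, Real.rpow_def_of_pos h0, mul_div_cancel₀ _ hlog.ne,
      Real.exp_neg, Real.exp_log two_pos]
  let digit : Bool → Fin 2 := fun b => if b then 1 else 0
  have hsurj : Icc (0 : ℝ) 1 ⊆ range fun x : ℕ → Bool => Real.ofDigits fun i => digit (x i) := by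
    intro t ht
    obtain ⟨d, -, rfl⟩ := Real.ofDigits_SurjOn one_lt_two ht
    refine ⟨fun i => decide (d i = 1), ?_⟩
    dsimp only
    congr 1
    funext i
    generalize d i = k
    fin_cases k <;> simp [digit]
  have hone : (1 : ℝ≥0∞) ≤ dimH (Icc (0 : ℝ) 1) := by
    rw [Real.dimH_of_nonempty_interior (by simp)]
    simp
  have hq : 0 < 1 - α ^ 2 := by nlinarith
  have hmain := dimH_range_le_of_coding (π := attractorCode α)
    (ρ := fun x : ℕ → Bool => Real.ofDigits fun i => digit (x i)) (C := 1) h0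
    (c := 2 * (1 - 2 * α ^ 2) / (1 - α ^ 2)) (div_pos (by linarith) hq) zero_le_one hr0 hab
    (fun n x y hxy hn => le_dist_attractorCode h0.le h1 hxy hn)
    (fun n x y hxy => by
      have := Real.abs_ofDigits_sub_ofDigits_le (x := fun i => digit (x i))
        (y := fun i => digit (y i)) (n := n) fun i hi => by simp only [hxy i hi]
      simpa [Real.dist_eq] using this)
  have h3 := (hone.trans (dimH_mono hsurj)).trans hmain
  rw [ENNReal.le_div_iff_mul_le (by simp [hr0.ne']) (by simp), one_mul] at h3
  exact h3

theorem dimH_range_attractorCode_le_of_lt_half {β : ℝ} (h0 : 0 < α) (h1 : α < 1) (hβ0 : 0 < β)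
    (hβ : β < 1 / 2) :
    dimH (range (attractorCode α)) ≤ ENNReal.ofReal (Real.log β / Real.log α) := by
  have hlα : Real.log α < 0 := Real.log_neg h0 h1
  have hlβ : Real.log β < 0 := Real.log_neg hβ0 (by linarith)
  have hd : 0 < Real.log α / Real.log β := div_pos_of_neg_of_neg hlα hlβ
  set r : ℝ≥0 := (Real.log α / Real.log β).toNNReal with hr
  have hr0 : 0 < r := Real.toNNReal_pos.2 hd
  have hab : β ^ (r : ℝ) = α := by
    rw [hr, Real.coe_toNNReal _ hd.le, Real.rpow_def_of_pos hβ0, mul_div_cancel₀ _ hlβ.ne,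
      Real.exp_log h0]
  have habs : |β| = β := abs_of_pos hβ0
  have hβ1 : |β| < 1 := by rw [habs]; linarith
  have hmain := dimH_range_le_of_coding (π := signSeries β) (ρ := attractorCode α)
    (c := 2 * (1 - 2 * β) / (1 - β)) hβ0 (div_pos (by linarith) (by linarith))
    Metric.diam_nonneg hr0 hab
    (fun n x y hxy hn => by
      rw [dist_coding (g := fun b t => sgn b + β * t) (a := β) ?_ ?_ n x y hxy, mul_comm]
      · gcongr
        have := le_dist_signSeries hβ1 (x := fun i => x (i + n)) (y := fun i => y (i + n))
          (by simpa using hn)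
        rwa [habs] at this
      · intro b p q
        rw [Real.dist_eq, Real.dist_eq, ← habs, ← abs_mul, habs]
        ring_nf
      · exact fun b x => signSeries_eq hβ1 _)
    (fun n x y hxy => dist_attractorCode_le h0.le h1 hxy)
  refine hmain.trans ?_
  calc dimH (range (signSeries β)) / r ≤ 1 / r := by
        gcongr
        exact (dimH_mono (subset_univ _)).trans Real.dimH_univ.le
    _ = ENNReal.ofReal (Real.log β / Real.log α) := by
        rw [← inv_div, ENNReal.ofReal_inv_of_pos hd, one_div]
        rfl

theorem dimH_range_attractorCode_le (h0 : 0 < α) (h1 : α < 1) :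
    dimH (range (attractorCode α)) ≤ ENNReal.ofReal (-(Real.log 2) / Real.log α) := by
  have hlim : Tendsto (fun β : ℝ => ENNReal.ofReal (Real.log β / Real.log α)) (𝓝[<] (1 / 2))
      (𝓝 (ENNReal.ofReal (-(Real.log 2) / Real.log α))) := by
    have : Real.log (1 / 2) = -Real.log 2 := by rw [one_div, Real.log_inv]
    rw [← this]
    exact ENNReal.tendsto_ofReal (((Real.continuousAt_log (by norm_num)).tendsto.mono_left
      nhdsWithin_le_nhds).div_const _)
  refine ge_of_tendsto hlim ?_
  filter_upwards [Ioo_mem_nhdsLT (show (0 : ℝ) < 1 / 2 by norm_num)] with β hβ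
  exact dimH_range_attractorCode_le_of_lt_half h0 h1 hβ.1 hβ.2

end Attractor

/-- For `α ∈ (1/2, 1/√2)`, the Hausdorff dimension of `S_α` equals
`-log 2 / log α = log 2 / log (1/α)`, which lies in `(1,2)`; in particular for
`h ∈ (1,2)` and `α = 2^(-1/h)` the Hausdorff dimension of `S_α` equals `h`. -/
theorem statement11 (α : ℝ) (hα : α ∈ Ioo (1/2 : ℝ) (Real.sqrt 2)⁻¹) :
    dimH (Sset α) = ENNReal.ofReal (-(Real.log 2) / Real.log α) ∧
    -(Real.log 2) / Real.log α = Real.log 2 / Real.log (1/α) ∧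
    -(Real.log 2) / Real.log α ∈ Ioo (1 : ℝ) 2 ∧
    (∀ h : ℝ, h ∈ Ioo (1 : ℝ) 2 → α = (2 : ℝ) ^ (-(1/h) : ℝ) →
      dimH (Sset α) = ENNReal.ofReal h) := by
  obtain ⟨hα1, hα2⟩ := hα
  have h0 : 0 < α := by linarith
  have hsq : 2 * α ^ 2 < 1 := by
    have h := pow_lt_pow_left₀ hα2 h0.le two_ne_zero
    rw [inv_pow, Real.sq_sqrt two_pos.le] at h
    linarith
  have h1 : α < 1 := by nlinarith
  have hlog : Real.log α < 0 := Real.log_neg h0 h1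
  have hmem : -(Real.log 2) / Real.log α ∈ Ioo (1 : ℝ) 2 := by
    constructor
    · rw [lt_div_iff_of_neg hlog, one_mul, ← Real.log_inv]
      exact Real.log_lt_log (by norm_num) (by linarith)
    · have h := Real.log_neg (by positivity) hsq
      rw [Real.log_mul two_ne_zero (by positivity), Real.log_pow] at h
      rw [div_lt_iff_of_neg hlog]
      push_cast at h
      linarith
  have hdim : dimH (Sset α) = ENNReal.ofReal (-(Real.log 2) / Real.log α) := by
    refine le_antisymm ((dimH_Sset_le h0.le h1).trans (max_le ?_ ?_)) ?_
    · exact dimH_range_attractorCode_le h0 h1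
    · exact ENNReal.one_le_ofReal.2 hmem.1.le
    · exact (le_dimH_range_attractorCode h0 hsq).trans
        (dimH_mono (range_attractorCode_subset_Sset h0.le h1))
  refine ⟨hdim, ?_, hmem, fun h hh hαh => ?_⟩
  · rw [one_div, Real.log_inv, div_neg, neg_div]
  · rw [hdim]
    have hh0 : h ≠ 0 := by linarith [hh.1]
    have hlog2 : Real.log 2 ≠ 0 := (Real.log_pos one_lt_two).ne'
    congr 1
    rw [hαh, Real.log_rpow two_pos]
    field_simp

end
end
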